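/- Let (T²,g) be a Riemannian torus (with no entropy assumption). For every r ∈ ℝ ∪ {∞} and every x ∈ T² there exists v ∈ S_xT² such that the geodesic c_v with c_v(0) = x, ċ_v(0) = v has a lift to ℝ² whose forward ray is escaping with well-defined rotation number ρ(c_v⁺) = r. In particular, for each fixed x ∈ T², the map f_x: E_x → ℝ ∪ {∞}, v ↦ ρ(v), is surjective, where E_x = {v ∈ S_xT² : ρ(v) exists}. -/

import Mathlib

open Filter Topology Set
open scoped ENNReal

noncomputable section

/-- The Euclidean norm of a point of `ℝ × ℝ` (the universal covering of `T²`). -/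
def norm2 (p : ℝ × ℝ) : ℝ := Real.sqrt (p.1 ^ 2 + p.2 ^ 2)

/-- The translation vector of the covering transformation `τ_{(m,n)}` of `T² = ℝ²/ℤ²`. -/
def lat (k : ℤ × ℤ) : ℝ × ℝ := ((k.1 : ℝ), (k.2 : ℝ))

/-- The transl of a curve in `ℝ²` by the covering transformation `τ_k`. -/
def transl (k : ℤ × ℤ) (c : ℝ → ℝ × ℝ) : ℝ → ℝ × ℝ := fun t => c t + lat k

/-- The asymptotic direction `δ(τ_k)` of the axes of the translation element `τ_k`. -/
def latDir (k : ℤ × ℤ) : ℝ × ℝ := (norm2 (lat k))⁻¹ • lat k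

/-- A smooth Riemannian metric on the torus `T² = ℝ²/ℤ²`, described through its lift to the
universal covering `ℝ²`: a smooth family of positive definite symmetric bilinear forms on the
tangent spaces of `ℝ²`, invariant under the deck transformation group `ℤ²`. -/
structure TorusMetric where
  g : (ℝ × ℝ) → (ℝ × ℝ) → (ℝ × ℝ) → ℝ
  smooth : ContDiff ℝ (⊤ : ℕ∞) fun p : (ℝ × ℝ) × (ℝ × ℝ) × (ℝ × ℝ) => g p.1 p.2.1 p.2.2
  symm : ∀ x v w, g x v w = g x w v
  linear : ∀ x w, IsLinearMap ℝ fun v => g x v w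
  posdef : ∀ x v, v ≠ 0 → 0 < g x v v
  periodic : ∀ (k : ℤ × ℤ) (x v w : ℝ × ℝ), g (x + lat k) v w = g x v w

namespace TorusMetric

/-- The Riemannian length of the curve `c` between the parameters `a` and `b`. -/
def length (M : TorusMetric) (c : ℝ → ℝ × ℝ) (a b : ℝ) : ℝ :=
  ∫ t in a..b, Real.sqrt (M.g (c t) (deriv c t) (deriv c t))

/-- The Riemannian distance on the universal covering `ℝ²` (hence also on `T²`). -/
def dist (M : TorusMetric) (x y : ℝ × ℝ) : ℝ :=
  sInf {L | ∃ c : ℝ → ℝ × ℝ, ContDiff ℝ 1 c ∧ c 0 = x ∧ c 1 = y ∧ L = M.length c 0 1}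

/-- A (complete, unit speed) geodesic of the lifted metric on the universal covering `ℝ²`:
a smooth curve with constant unit speed which is locally length minimizing. -/
def IsGeodesic (M : TorusMetric) (c : ℝ → ℝ × ℝ) : Prop :=
  ContDiff ℝ (⊤ : ℕ∞) c ∧ (∀ t, M.g (c t) (deriv c t) (deriv c t) = 1) ∧
    ∀ t : ℝ, ∃ ε > 0, ∀ s₁ s₂, t - ε ≤ s₁ → s₁ ≤ s₂ → s₂ ≤ t + ε →
      M.dist (c s₁) (c s₂) = M.length c s₁ s₂

end TorusMetric

/-- The distance between two points of the unit tangent bundle `ST²` of the torus; points of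
`ST²` are represented by points of the tangent bundle `ℝ² × ℝ²` of the universal covering
(the deck transformations act trivially on the vector component). -/
def phaseDist (p q : (ℝ × ℝ) × (ℝ × ℝ)) : ℝ :=
  sInf {r : ℝ | ∃ k : ℤ × ℤ, r = norm2 (p.1 - (q.1 + lat k)) + norm2 (p.2 - q.2)}

/-- A `(φ,ε)`-separated set with respect to time `T` for the geodesic flow `φ` of `M` on
`ST²`: a finite family of geodesics (each geodesic `c` representing the phase point
`(c 0, ċ 0) ∈ ST²`, of which `t ↦ (c t, ċ t)` is the flow orbit) such that any two distinct
members satisfy `max_{0 ≤ t ≤ T} d(φᵗ v, φᵗ w) > ε`. -/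
def IsSeparated (M : TorusMetric) (ε T : ℝ) (F : Finset (ℝ → ℝ × ℝ)) : Prop :=
  (∀ c ∈ F, M.IsGeodesic c) ∧
    ∀ c₁ ∈ F, ∀ c₂ ∈ F, c₁ ≠ c₂ →
      ∃ t ∈ Set.Icc (0 : ℝ) T, ε < phaseDist (c₁ t, deriv c₁ t) (c₂ t, deriv c₂ t)

/-- `r_T(φ, ε)`: the maximal cardinality of `(φ,ε)`-separated sets with respect to `T`. -/
def sepCount (M : TorusMetric) (ε T : ℝ) : ℝ≥0∞ :=
  ⨆ (F : Finset (ℝ → ℝ × ℝ)) (_ : IsSeparated M ε T F), (F.card : ℝ≥0∞)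

/-- Extended real logarithm of an extended nonnegative real. -/
def elog (x : ℝ≥0∞) : EReal :=
  if x = 0 then ⊥ else if x = ⊤ then ⊤ else ((Real.log x.toReal : ℝ) : EReal)

/-- Bowen's topological entropy `h_top(g)` of the geodesic flow of `g` on `ST²`:
`lim_{ε → 0} limsup_{T → ∞} (1/T) log r_T(φ,ε)`; since `r_T(φ,ε)` is monotone in `ε`,
the limit `ε → 0` is realized as the supremum over `ε > 0`. -/
def topEnt (M : TorusMetric) : EReal :=
  ⨆ (ε : ℝ) (_ : 0 < ε),
    Filter.limsup (fun T : ℝ => ((T⁻¹ : ℝ) : EReal) * elog (sepCount M ε T)) Filter.atTop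

/-- The forward ray `c⁺` of `c` is escaping: `‖c(t)‖ → ∞` as `t → ∞`. -/
def EscapesForward (c : ℝ → ℝ × ℝ) : Prop :=
  Filter.Tendsto (fun t => norm2 (c t)) Filter.atTop Filter.atTop

/-- The backward ray `c⁻` of `c` is escaping: `‖c(-t)‖ → ∞` as `t → ∞`. -/
def EscapesBackward (c : ℝ → ℝ × ℝ) : Prop :=
  Filter.Tendsto (fun t => norm2 (c (-t))) Filter.atTop Filter.atTop

/-- `z ∈ S¹` is the asymptotic direction `δ(c⁺) = lim_{t → ∞} c(t)/‖c(t)‖` of the forward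
ray of `c`. -/
def HasDirection (c : ℝ → ℝ × ℝ) (z : ℝ × ℝ) : Prop :=
  norm2 z = 1 ∧ Filter.Tendsto (fun t => (norm2 (c t))⁻¹ • c t) Filter.atTop (nhds z)

/-- The canonical projection `π : S¹ → P¹(ℝ) ≅ ℝ ∪ {∞}`, sending `(x, y)` to `y/x` if
`x ≠ 0` and to `∞` otherwise; `ℝ ∪ {∞}` is the one-point compactification of `ℝ`. -/
def projPt (z : ℝ × ℝ) : OnePoint ℝ :=
  if z.1 = 0 then OnePoint.infty else ((z.2 / z.1 : ℝ) : OnePoint ℝ)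

/-- `crossDet v w ≠ 0` expresses transversality of two directions in `ℝ²`. -/
def crossDet (v w : ℝ × ℝ) : ℝ := v.1 * w.2 - v.2 * w.1

/-- The set of points at which the curve `c₁` (restricted to parameters in `D₁`) and the
curve `c₂` (restricted to parameters in `D₂`) intersect transversally. -/
def transInter (c₁ c₂ : ℝ → ℝ × ℝ) (D₁ D₂ : Set ℝ) : Set (ℝ × ℝ) :=
  {x | ∃ s ∈ D₁, ∃ t ∈ D₂, c₁ s = x ∧ c₂ t = x ∧ crossDet (deriv c₁ s) (deriv c₂ t) ≠ 0}

/-- The geodesic `c` is an axis of the (nontrivial) translation element `τ_k`: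
`τ_k c(t) = c(t + ℓ)` for some `ℓ` and all `t`. -/
def IsAxisOf (M : TorusMetric) (c : ℝ → ℝ × ℝ) (k : ℤ × ℤ) : Prop :=
  M.IsGeodesic c ∧ k ≠ 0 ∧ ∃ ℓ : ℝ, ∀ t, c (t + ℓ) = c t + lat k

/-- The geodesic `c` is an axis of some nontrivial translation element. -/
def IsAxis (M : TorusMetric) (c : ℝ → ℝ × ℝ) : Prop := ∃ k : ℤ × ℤ, IsAxisOf M c k

/-- The curve `c` is minimal: each of its segments minimizes the Riemannian length between
its endpoints. -/
def IsMinimal (M : TorusMetric) (c : ℝ → ℝ × ℝ) : Prop :=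
  ∀ s t : ℝ, s ≤ t → M.dist (c s) (c t) = M.length c s t

/-- Equivalence of translation elements: `τ₁^a = τ₂^b` for some nonzero integers `a, b`. -/
def TransEquiv (k₁ k₂ : ℤ × ℤ) : Prop := ∃ a b : ℤ, a ≠ 0 ∧ b ≠ 0 ∧ a • k₁ = b • k₂

/-- A translation element is primitive if it is not a nontrivial power of another
translation element. -/
def IsPrimitive (k : ℤ × ℤ) : Prop := k ≠ 0 ∧ ∀ (j : ℤ × ℤ) (n : ℤ), k = n • j → IsUnit n

/-- The metric `g` on `T²` is flat, i.e. its Gaussian curvature vanishes identically;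
equivalently (by the theorems of Myers–Steenrod and Cartan–Hadamard), the universal covering
`ℝ²` with the induced Riemannian distance is isometric to the Euclidean plane. -/
def IsFlat (M : TorusMetric) : Prop :=
  ∃ F : (ℝ × ℝ) ≃ (ℝ × ℝ), ∀ x y, M.dist x y = norm2 (F x - F y)

section

set_option maxSynthPendingDepth 3

theorem exists_lat_add_mem_Icc (x : ℝ × ℝ) : ∃ k : ℤ × ℤ, x + lat k ∈ Icc (0 : ℝ × ℝ) 1 := by
  refine ⟨(-⌊x.1⌋, -⌊x.2⌋), ?_⟩
  have h1 := Int.floor_le x.1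
  have h2 := Int.floor_le x.2
  have h3 := (Int.lt_floor_add_one x.1).le
  have h4 := (Int.lt_floor_add_one x.2).le
  simp only [lat, Set.mem_Icc, Prod.le_def, Prod.fst_add, Prod.snd_add, Int.cast_neg, Prod.fst_zero,
    Prod.snd_zero, Prod.fst_one, Prod.snd_one]
  refine ⟨⟨?_, ?_⟩, ?_, ?_⟩ <;> linarith

theorem lat_add (k l : ℤ × ℤ) : lat (k + l) = lat k + lat l := by
  simp [lat]

theorem lat_neg (k : ℤ × ℤ) : lat (-k) = -lat k := by
  simp [lat]

theorem lat_nsmul (n : ℕ) (k : ℤ × ℤ) : lat (n • k) = (n : ℝ) • lat k := by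
  simp [lat]

theorem lat_zsmul (n : ℤ) (k : ℤ × ℤ) : lat (n • k) = (n : ℝ) • lat k := by
  simp [lat]

theorem lat_ne_zero {k : ℤ × ℤ} (hk : k ≠ 0) : lat k ≠ 0 := by
  contrapose! hk
  simpa [lat, Prod.ext_iff] using hk

/-- A continuous function that is `ℤ²`-periodic in the first variable and vanishes outside a
compact set in the second one is bounded. -/
theorem exists_bound_of_periodic {Y F : Type*} [TopologicalSpace Y] [NormedAddCommGroup F]
    {f : (ℝ × ℝ) × Y → F} {K : Set Y} (hK : IsCompact K) (hf : Continuous f)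
    (hp : ∀ (k : ℤ × ℤ) x y, f (x + lat k, y) = f (x, y)) (h0 : ∀ x y, y ∉ K → f (x, y) = 0) :
    ∃ C > 0, ∀ p, ‖f p‖ ≤ C := by
  obtain ⟨C, hC⟩ := ((isCompact_Icc (a := (0 : ℝ × ℝ)) (b := 1)).prod hK).exists_bound_of_continuousOn
    hf.continuousOn
  refine ⟨max C 1, by positivity, fun p => ?_⟩
  obtain ⟨x, y⟩ := p
  by_cases hy : y ∈ K
  · obtain ⟨k, hk⟩ := exists_lat_add_mem_Icc x
    rw [← hp k]
    exact (hC (x + lat k, y) ⟨hk, hy⟩).trans (le_max_left _ _)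
  · rw [h0 x y hy, norm_zero]
    positivity

theorem exists_bound_of_periodic' {F : Type*} [NormedAddCommGroup F]
    {f : ℝ × ℝ → F} (hf : Continuous f) (hp : ∀ (k : ℤ × ℤ) x, f (x + lat k) = f x) :
    ∃ C > 0, ∀ x, ‖f x‖ ≤ C := by
  obtain ⟨C, h0, hC⟩ := exists_bound_of_periodic (Y := Unit) (f := fun p => f p.1) isCompact_univ
    (by fun_prop) (fun k x _ => hp k x) (by simp)
  exact ⟨C, h0, fun x => hC (x, ())⟩

namespace TorusMetric

variable (M : TorusMetric)

/-- The metric as a map into continuous bilinear forms. -/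
def bilin (x : ℝ × ℝ) : (ℝ × ℝ) →L[ℝ] (ℝ × ℝ) →L[ℝ] ℝ :=
  LinearMap.toContinuousLinearMap
    { toFun := fun v => LinearMap.toContinuousLinearMap
        { toFun := fun w => M.g x v w
          map_add' := fun w w' => by
            rw [M.symm x v, M.symm x v w, M.symm x v w', (M.linear x v).map_add]
          map_smul' := fun a w => by
            rw [M.symm x v, M.symm x v w, (M.linear x v).map_smul]; rfl }
      map_add' := fun v v' => by ext <;> simp [(M.linear x _).map_add]
      map_smul' := fun a v => by ext <;> simp [(M.linear x _).map_smul] }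

@[simp] theorem bilin_apply (x v w : ℝ × ℝ) : M.bilin x v w = M.g x v w := rfl

theorem contDiff_bilin : ContDiff ℝ (⊤ : ℕ∞) M.bilin := by
  rw [contDiff_clm_apply_iff]
  intro v
  rw [contDiff_clm_apply_iff]
  intro w
  exact M.smooth.comp (contDiff_id.prodMk (contDiff_const (c := (v, w))))

theorem bilin_add_lat (k : ℤ × ℤ) (x : ℝ × ℝ) : M.bilin (x + lat k) = M.bilin x := by
  ext <;> simp [M.periodic]

theorem fderiv_bilin_add_lat (k : ℤ × ℤ) (x : ℝ × ℝ) :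
    fderiv ℝ M.bilin (x + lat k) = fderiv ℝ M.bilin x := by
  rw [← fderiv_comp_add_right (f := M.bilin)]
  congr 1
  exact funext fun y => M.bilin_add_lat k y

theorem fderiv_fderiv_bilin_add_lat (k : ℤ × ℤ) (x : ℝ × ℝ) :
    fderiv ℝ (fderiv ℝ M.bilin) (x + lat k) = fderiv ℝ (fderiv ℝ M.bilin) x := by
  rw [← fderiv_comp_add_right (f := fderiv ℝ M.bilin)]
  congr 1
  exact funext fun y => M.fderiv_bilin_add_lat k y

theorem contDiff_fderiv_bilin : ContDiff ℝ (⊤ : ℕ∞) (fderiv ℝ M.bilin) :=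
  M.contDiff_bilin.fderiv_right (by simp)

theorem exists_lower : ∃ l > 0, ∀ x v : ℝ × ℝ, l * ‖v‖ ^ 2 ≤ M.g x v v := by
  have hc : Continuous fun p : (ℝ × ℝ) × (ℝ × ℝ) => M.g p.1 p.2 p.2 :=
    M.smooth.continuous.comp (by fun_prop : Continuous fun p : (ℝ × ℝ) × (ℝ × ℝ) => (p.1, p.2, p.2))
  have hK : IsCompact (Icc (0 : ℝ × ℝ) 1 ×ˢ Metric.sphere (0 : ℝ × ℝ) 1) :=
    isCompact_Icc.prod (isCompact_sphere _ _)
  have hne : (Icc (0 : ℝ × ℝ) 1 ×ˢ Metric.sphere (0 : ℝ × ℝ) 1).Nonempty :=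
    ⟨(0, (1, 0)), by simp, by simp [Prod.norm_def]⟩
  obtain ⟨p, hp, hmin⟩ := hK.exists_isMinOn hne hc.continuousOn
  have hp2 : p.2 ≠ 0 := by
    have := hp.2
    rintro h
    simp [h] at this
  refine ⟨M.g p.1 p.2 p.2, M.posdef _ _ hp2, fun x v => ?_⟩
  by_cases hv : v = 0
  · subst hv
    have := M.bilin_apply x 0 0
    simp at this
    simp [← this]
  obtain ⟨k, hk⟩ := exists_lat_add_mem_Icc x
  have hv' : 0 < ‖v‖ := norm_pos_iff.2 hv
  have h1 := hmin (show (x + lat k, ‖v‖⁻¹ • v) ∈ _ from ⟨hk, by simp [norm_smul, hv'.ne']⟩)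
  simp only [Set.mem_ofPred_eq, M.periodic] at h1
  have h2 : M.g x (‖v‖⁻¹ • v) (‖v‖⁻¹ • v) = ‖v‖⁻¹ * (‖v‖⁻¹ * M.g x v v) := by
    simp only [← bilin_apply, map_smul, _root_.smul_apply, smul_eq_mul]
  rw [h2] at h1
  calc _ ≤ ‖v‖⁻¹ * (‖v‖⁻¹ * M.g x v v) * ‖v‖ ^ 2 := by gcongr
    _ = _ := by field_simp

theorem exists_upper : ∃ u > 0, ∀ x v w : ℝ × ℝ, |M.g x v w| ≤ u * ‖v‖ * ‖w‖ := by
  obtain ⟨C, h0, hC⟩ := exists_bound_of_periodic' M.contDiff_bilin.continuous M.bilin_add_lat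
  refine ⟨C, h0, fun x v w => ?_⟩
  exact ((M.bilin x).le_opNorm₂ v w).trans (by gcongr; exact hC x)

theorem exists_fderiv_bound : ∃ K > 0, (∀ x, ‖fderiv ℝ M.bilin x‖ ≤ K) ∧
    (∀ x y, ‖M.bilin y - M.bilin x‖ ≤ K * ‖y - x‖) ∧
    ∀ x y, ‖M.bilin y - M.bilin x - fderiv ℝ M.bilin x (y - x)‖ ≤ K * ‖y - x‖ ^ 2 := by
  obtain ⟨C, h0, hC⟩ := exists_bound_of_periodic' M.contDiff_fderiv_bilin.continuous
    M.fderiv_bilin_add_lat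
  obtain ⟨C', h0', hC'⟩ := exists_bound_of_periodic'
    (M.contDiff_fderiv_bilin.continuous_fderiv (by simp)) M.fderiv_fderiv_bilin_add_lat
  have hd := M.contDiff_bilin.differentiable (by simp)
  have hd' := M.contDiff_fderiv_bilin.differentiable (by simp)
  refine ⟨max C C', by positivity, fun x => (hC x).trans (le_max_left _ _), fun x y => ?_,
    fun x y => ?_⟩
  · refine (convex_univ.norm_image_sub_le_of_norm_fderiv_le (fun z _ => hd z)
      (fun z _ => hC z) (mem_univ x) (mem_univ y)).trans ?_
    gcongr
    exact le_max_left _ _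
  · have h1 : ∀ z ∈ Metric.closedBall x ‖y - x‖,
        ‖fderiv ℝ M.bilin z - fderiv ℝ M.bilin x‖ ≤ max C C' * ‖y - x‖ := by
      intro z hz
      refine (convex_univ.norm_image_sub_le_of_norm_fderiv_le (fun z _ => hd' z)
        (fun z _ => hC' z) (mem_univ x) (mem_univ z)).trans ?_
      rw [mem_closedBall_iff_norm] at hz
      gcongr
      exact le_max_right _ _
    have := (convex_closedBall x ‖y - x‖).norm_image_sub_le_of_norm_hasFDerivWithin_le'
      (fun z _ => (hd z).hasFDerivAt.hasFDerivWithinAt) h1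
      (Metric.mem_closedBall_self (norm_nonneg _)) (mem_closedBall_iff_norm.2 le_rfl)
    rwa [mul_assoc, ← pow_two] at this

end TorusMetric

open scoped NNReal in
/-- A bounded Lipschitz vector field has global integral curves. -/
theorem exists_global_integralCurve {F : Type*} [NormedAddCommGroup F] [NormedSpace ℝ F]
    [CompleteSpace F] {f : F → F} {K : ℝ≥0} (hf : LipschitzWith K f) {B : ℝ} (hB : 0 < B)
    (hb : ∀ x, ‖f x‖ ≤ B) (x : F) :
    ∃ z : ℝ → F, z 0 = x ∧ ∀ t, HasDerivAt z (f (z t)) t := by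
  have key : ∀ n : ℕ, ∃ z : ℝ → F, z 0 = x ∧
      ∀ t ∈ Icc (-(n + 1 : ℝ)) (n + 1), HasDerivWithinAt z (f (z t)) (Icc (-(n + 1 : ℝ)) (n + 1)) t := by
    intro n
    have hn : (0 : ℝ) ∈ Icc (-(n + 1 : ℝ)) (n + 1) := ⟨by linarith [n.cast_nonneg (α := ℝ)], by positivity⟩
    have := IsPicardLindelof.of_time_independent (f := f) (t₀ := ⟨0, hn⟩) (x₀ := x)
      (a := ⟨B * (n + 1), by positivity⟩) (r := 0) (L := ⟨B, hB.le⟩) (K := K)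
      (fun y _ => hb y) (hf.lipschitzOnWith) (by simp; exact le_rfl)
    exact this.exists_eq_forall_mem_Icc_hasDerivWithinAt₀
  choose z hz0 hz using key
  have hz' : ∀ (n : ℕ), ∀ t ∈ Ioo (-(n + 1 : ℝ)) (n + 1), HasDerivAt (z n) (f (z n t)) t :=
    fun n t ht => (hz n t (Ioo_subset_Icc_self ht)).hasDerivAt (Icc_mem_nhds ht.1 ht.2)
  have huniq : ∀ m n : ℕ, m ≤ n → EqOn (z m) (z n) (Ioo (-(m + 1 : ℝ)) (m + 1)) := by
    intro m n hmn
    have h1 : (m : ℝ) ≤ n := by exact_mod_cast hmn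
    refine ODE_solution_unique_of_mem_Ioo (v := fun _ => f) (s := fun _ => univ) (K := K) (t₀ := 0)
      (fun _ _ => hf.lipschitzOnWith) ⟨by linarith [m.cast_nonneg (α := ℝ)], by positivity⟩
      (fun t ht => ⟨hz' m t ht, mem_univ _⟩)
      (fun t ht => ⟨hz' n t ⟨by linarith [ht.1], by linarith [ht.2]⟩, mem_univ _⟩)
      (by rw [hz0, hz0])
  refine ⟨fun t => z ⌈|t|⌉₊ t, by simp [hz0], fun t => ?_⟩
  set N := ⌈|t| + 1⌉₊
  have hN : |t| + 1 ≤ N := Nat.le_ceil _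
  have hloc : ∀ s ∈ Ioo (t - 1) (t + 1), z ⌈|s|⌉₊ s = z N s := by
    intro s hs
    have h1 : |s| ≤ |t| + 1 := by
      rw [abs_le]
      constructor <;> cases abs_cases t <;> linarith [hs.1, hs.2]
    have h2 := Nat.le_ceil |s|
    refine huniq _ _ (Nat.ceil_mono h1) ⟨?_, ?_⟩ <;> cases abs_cases s <;> linarith
  have h3 : z ⌈|t|⌉₊ t = z N t := hloc t ⟨by linarith, by linarith⟩
  show HasDerivAt (fun t => z ⌈|t|⌉₊ t) (f (z ⌈|t|⌉₊ t)) t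
  rw [h3]
  have h4 := hz' N t ⟨by cases abs_cases t <;> linarith, by cases abs_cases t <;> linarith⟩
  refine h4.congr_of_eventuallyEq ?_
  filter_upwards [Ioo_mem_nhds (by linarith : t - 1 < t) (by linarith : t < t + 1)] with s hs
  exact hloc s hs

namespace TorusMetric

variable (M : TorusMetric)

/-- The covector `½ Dg[·](v, v) - Dg[v](v, ·)`. -/
def force (x v : ℝ × ℝ) : (ℝ × ℝ) →L[ℝ] ℝ :=
  (1 / 2 : ℝ) • (((fderiv ℝ M.bilin x).flip v).flip v) - fderiv ℝ M.bilin x v v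

theorem force_apply (x v w : ℝ × ℝ) : M.force x v w =
    (1 / 2 : ℝ) * fderiv ℝ M.bilin x w v v - fderiv ℝ M.bilin x v v w := by
  simp [force]

/-- The acceleration of the geodesic equation. -/
def accel (x v : ℝ × ℝ) : ℝ × ℝ := (M.bilin x).inverse (M.force x v)

theorem exists_equiv_bilin (x : ℝ × ℝ) :
    ∃ e : (ℝ × ℝ) ≃L[ℝ] ((ℝ × ℝ) →L[ℝ] ℝ), (e : (ℝ × ℝ) →L[ℝ] (ℝ × ℝ) →L[ℝ] ℝ) = M.bilin x := by
  have hinj : Function.Injective (M.bilin x : (ℝ × ℝ) →ₗ[ℝ] ((ℝ × ℝ) →L[ℝ] ℝ)) := by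
    rw [← LinearMap.ker_eq_bot, LinearMap.ker_eq_bot']
    intro v hv
    by_contra h
    have h1 := M.posdef x v h
    have h2 := DFunLike.congr_fun hv v
    simp at h2
    linarith
  have hdim : Module.finrank ℝ (ℝ × ℝ) = Module.finrank ℝ ((ℝ × ℝ) →L[ℝ] ℝ) := by
    rw [← LinearEquiv.finrank_eq (LinearMap.toContinuousLinearMap (𝕜 := ℝ) (E := ℝ × ℝ) (F' := ℝ))]
    exact (Subspace.dual_finrank_eq (K := ℝ) (V := ℝ × ℝ)).symm
  refine ⟨(LinearEquiv.ofInjectiveOfFinrankEq _ hinj hdim).toContinuousLinearEquiv, ?_⟩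
  ext <;> rfl

theorem bilin_accel (x v : ℝ × ℝ) : M.bilin x (M.accel x v) = M.force x v := by
  obtain ⟨e, he⟩ := M.exists_equiv_bilin x
  rw [accel, ← he]
  simp

theorem bilin_accel_apply (x v w : ℝ × ℝ) : M.g x (M.accel x v) w =
    (1 / 2 : ℝ) * fderiv ℝ M.bilin x w v v - fderiv ℝ M.bilin x v v w := by
  rw [← bilin_apply, bilin_accel, force_apply]

theorem contDiff_force : ContDiff ℝ (⊤ : ℕ∞) fun p : (ℝ × ℝ) × (ℝ × ℝ) => M.force p.1 p.2 := by
  rw [contDiff_clm_apply_iff]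
  intro w
  simp only [force_apply]
  have h := M.contDiff_fderiv_bilin.comp (contDiff_fst (𝕜 := ℝ) (E := ℝ × ℝ) (F := ℝ × ℝ))
  simp only [Function.comp_def] at h
  exact (contDiff_const.mul (((h.clm_apply contDiff_const).clm_apply contDiff_snd).clm_apply
    contDiff_snd)).sub (((h.clm_apply contDiff_snd).clm_apply contDiff_snd).clm_apply contDiff_const)

theorem contDiff_accel : ContDiff ℝ (⊤ : ℕ∞) fun p : (ℝ × ℝ) × (ℝ × ℝ) => M.accel p.1 p.2 := by
  have h : ContDiff ℝ (⊤ : ℕ∞) fun p : (ℝ × ℝ) × (ℝ × ℝ) => (M.bilin p.1).inverse := by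
    rw [contDiff_iff_contDiffAt]
    intro p
    obtain ⟨e, he⟩ := M.exists_equiv_bilin p.1
    have h1 := contDiffAt_map_inverse (𝕜 := ℝ) (n := (⊤ : ℕ∞)) e
    rw [he] at h1
    exact h1.comp p (M.contDiff_bilin.comp contDiff_fst).contDiffAt
  exact h.clm_apply M.contDiff_force

theorem accel_add_lat (k : ℤ × ℤ) (x v : ℝ × ℝ) : M.accel (x + lat k) v = M.accel x v := by
  simp [accel, force, M.bilin_add_lat, M.fderiv_bilin_add_lat]

theorem accel_smul (a : ℝ) (x v : ℝ × ℝ) : M.accel x (a • v) = a ^ 2 • M.accel x v := by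
  have : M.force x (a • v) = a ^ 2 • M.force x v := by
    refine ContinuousLinearMap.ext fun w => ?_
    simp only [force_apply, map_smul, _root_.smul_apply, smul_eq_mul]
    ring
  rw [accel, this, map_smul, accel]

/-- The geodesic vector field, cut off at high speeds. -/
def field (p : (ℝ × ℝ) × (ℝ × ℝ)) : (ℝ × ℝ) × (ℝ × ℝ) :=
  Real.smoothTransition (6 - M.g p.1 p.2 p.2) • (p.2, M.accel p.1 p.2)

theorem contDiff_speed : ContDiff ℝ (⊤ : ℕ∞) fun p : (ℝ × ℝ) × (ℝ × ℝ) => M.g p.1 p.2 p.2 :=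
  M.smooth.comp (contDiff_fst.prodMk (contDiff_snd.prodMk contDiff_snd))

theorem contDiff_field : ContDiff ℝ (⊤ : ℕ∞) M.field :=
  (Real.smoothTransition.contDiff.comp (contDiff_const.sub M.contDiff_speed)).smul
    (contDiff_snd.prodMk M.contDiff_accel)

theorem field_add_lat (k : ℤ × ℤ) (p : (ℝ × ℝ) × (ℝ × ℝ)) :
    M.field (p + (lat k, 0)) = M.field p := by
  simp [field, M.accel_add_lat, M.periodic]

theorem field_eq {x v : ℝ × ℝ} (h : M.g x v v ≤ 5) : M.field (x, v) = (v, M.accel x v) := by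
  simp only [field]
  rw [Real.smoothTransition.one_of_one_le (by linarith), one_smul]

open scoped NNReal in
theorem exists_field_bound : ∃ K : ℝ≥0, ∃ B > 0, LipschitzWith K M.field ∧ ∀ p, ‖M.field p‖ ≤ B := by
  obtain ⟨l, hl, hlow⟩ := M.exists_lower
  set C : Set (ℝ × ℝ) := Metric.closedBall 0 √(6 / l)
  have hC : IsCompact C := isCompact_closedBall _ _
  have h0 : ∀ x v, v ∉ C → M.field (x, v) = 0 := by
    intro x v hv
    have h1 : √(6 / l) < ‖v‖ := by simpa [C] using hv
    have h2 : 6 / l < ‖v‖ ^ 2 := by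
      rwa [Real.sqrt_lt' ((Real.sqrt_nonneg _).trans_lt h1)] at h1
    have h3 := hlow x v
    have h4 : 6 ≤ M.g x v v := by
      refine le_trans ?_ h3
      rw [div_lt_iff₀ hl] at h2
      linarith
    simp only [field]
    rw [Real.smoothTransition.zero_of_nonpos (by linarith), zero_smul]
  obtain ⟨B, hB0, hB⟩ := exists_bound_of_periodic hC M.contDiff_field.continuous
    (fun k x v => by simpa using M.field_add_lat k (x, v)) h0
  have hper : ∀ (k : ℤ × ℤ) (x v), fderiv ℝ M.field (x + lat k, v) = fderiv ℝ M.field (x, v) := by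
    intro k x v
    have : (x + lat k, v) = (x, v) + (lat k, (0 : ℝ × ℝ)) := by simp
    rw [this, ← fderiv_comp_add_right (f := M.field)]
    congr 1
    exact funext fun y => M.field_add_lat k y
  have h0' : ∀ x v, v ∉ C → fderiv ℝ M.field (x, v) = 0 := by
    intro x v hv
    have hopen : {p : (ℝ × ℝ) × (ℝ × ℝ) | p.2 ∉ C} ∈ 𝓝 (x, v) :=
      (hC.isClosed.isOpen_compl.preimage continuous_snd).mem_nhds hv
    have : M.field =ᶠ[𝓝 (x, v)] fun _ => 0 := by
      filter_upwards [hopen] with p hp using h0 p.1 p.2 hp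
    rw [this.fderiv_eq]
    simp
  obtain ⟨K, hK0, hK⟩ := exists_bound_of_periodic hC (M.contDiff_field.continuous_fderiv (by simp))
    hper h0'
  refine ⟨⟨K, hK0.le⟩, B, hB0, ?_, hB⟩
  exact lipschitzWith_of_nnnorm_fderiv_le (M.contDiff_field.differentiable (by simp)) hK

theorem exists_integralCurve (p : (ℝ × ℝ) × (ℝ × ℝ)) :
    ∃ z : ℝ → (ℝ × ℝ) × (ℝ × ℝ), z 0 = p ∧ ∀ t, HasDerivAt z (M.field (z t)) t := by
  obtain ⟨K, B, hB, hL, hb⟩ := M.exists_field_bound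
  exact exists_global_integralCurve hL hB hb p

theorem hasDerivAt_bilin {e y₁ y₂ : ℝ → ℝ × ℝ} {e' y₁' y₂' : ℝ × ℝ} {t : ℝ} (he : HasDerivAt e e' t)
    (h₁ : HasDerivAt y₁ y₁' t) (h₂ : HasDerivAt y₂ y₂' t) :
    HasDerivAt (fun s => M.g (e s) (y₁ s) (y₂ s))
      (fderiv ℝ M.bilin (e t) e' (y₁ t) (y₂ t) + M.g (e t) y₁' (y₂ t) + M.g (e t) (y₁ t) y₂') t := by
  have h := ((M.contDiff_bilin.differentiable (by simp) (e t)).hasFDerivAt.comp_hasDerivAt t he)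
  have := (h.clm_apply h₁).clm_apply h₂
  simpa using this

theorem speed_integralCurve {z : ℝ → (ℝ × ℝ) × (ℝ × ℝ)}
    (hz : ∀ t, HasDerivAt z (M.field (z t)) t) (t : ℝ) :
    M.g (z t).1 (z t).2 (z t).2 = M.g (z 0).1 (z 0).2 (z 0).2 := by
  refine is_const_of_deriv_eq_zero (f := fun t => M.g (z t).1 (z t).2 (z t).2) (fun s => ?_)
    (fun s => ?_) t 0
  · exact (M.hasDerivAt_bilin (hz s).fst (hz s).snd (hz s).snd).differentiableAt
  · rw [(M.hasDerivAt_bilin (hz s).fst (hz s).snd (hz s).snd).deriv]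
    have h1 := M.bilin_accel_apply (z s).1 (z s).2 (z s).2
    have h2 := M.symm (z s).1 (z s).2 (M.accel (z s).1 (z s).2)
    simp only [field, Prod.smul_fst, Prod.smul_snd]
    simp only [← bilin_apply, map_smul, _root_.smul_apply, smul_eq_mul] at h1 h2 ⊢
    rw [h2, h1]
    ring

/-- `e` is a unit speed solution of the geodesic equation with velocity `y`. -/
structure IsSol (e y : ℝ → ℝ × ℝ) : Prop where
  pos : ∀ t, HasDerivAt e (y t) t
  vel : ∀ t, HasDerivAt y (M.accel (e t) (y t)) t
  unit : ∀ t, M.g (e t) (y t) (y t) = 1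

variable {M}

theorem IsSol.integralCurve {e y : ℝ → ℝ × ℝ} (h : M.IsSol e y) (t : ℝ) :
    HasDerivAt (fun t => (e t, y t)) (M.field (e t, y t)) t := by
  rw [M.field_eq (by rw [h.unit]; norm_num)]
  exact (h.pos t).prodMk (h.vel t)

theorem isSol_of_integralCurve {z : ℝ → (ℝ × ℝ) × (ℝ × ℝ)}
    (hz : ∀ t, HasDerivAt z (M.field (z t)) t) {a : ℝ} (ha : a ≠ 0) (ha2 : a ^ 2 ≤ 5)
    (h0 : M.g (z 0).1 (z 0).2 (z 0).2 = a ^ 2) :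
    M.IsSol (fun t => (z (a⁻¹ * t)).1) (fun t => a⁻¹ • (z (a⁻¹ * t)).2) := by
  have hs := fun t => (M.speed_integralCurve hz t).trans h0
  have hf : ∀ t, M.field (z t) = ((z t).2, M.accel (z t).1 (z t).2) :=
    fun t => M.field_eq ((hs t).trans_le ha2)
  have hd : ∀ t, HasDerivAt (fun t => z (a⁻¹ * t)) (a⁻¹ • M.field (z (a⁻¹ * t))) t := by
    intro t
    have := (hz (a⁻¹ * t)).scomp t ((hasDerivAt_id t).const_mul a⁻¹)
    rwa [mul_one] at this
  refine ⟨fun t => ?_, fun t => ?_, fun t => ?_⟩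
  · have := (hd t).fst
    rwa [hf] at this
  · have h1 := (hd t).snd
    rw [hf] at h1
    have h2 : HasDerivAt (fun t => (z (a⁻¹ * t)).2)
      (a⁻¹ • M.accel (z (a⁻¹ * t)).1 (z (a⁻¹ * t)).2) t := h1
    rw [accel_smul, pow_two, mul_smul]
    exact h2.const_smul a⁻¹
  · have := hs (a⁻¹ * t)
    simp only [← bilin_apply, map_smul, _root_.smul_apply, smul_eq_mul] at this ⊢
    rw [this]
    field_simp

theorem IsSol.ext {e y e' y' : ℝ → ℝ × ℝ} (h : M.IsSol e y) (h' : M.IsSol e' y') {t : ℝ}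
    (he : e t = e' t) (hy : y t = y' t) : e = e' := by
  obtain ⟨K, B, hB, hL, hb⟩ := M.exists_field_bound
  have := ODE_solution_unique_univ (v := fun _ => M.field) (s := fun _ => univ) (t₀ := t) (K := K)
    (fun _ => hL.lipschitzOnWith) (fun t => ⟨h.integralCurve t, mem_univ _⟩)
    (fun t => ⟨h'.integralCurve t, mem_univ _⟩) (by simp [he, hy])
  exact funext fun s => congrArg Prod.fst (congrFun this s)

theorem IsSol.ext_of_eqOn {e y e' y' : ℝ → ℝ × ℝ} (h : M.IsSol e y) (h' : M.IsSol e' y') {a b : ℝ}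
    (hab : a < b) (he : EqOn e e' (Icc a b)) : e = e' := by
  have hm : (a + b) / 2 ∈ Ioo a b := ⟨by linarith, by linarith⟩
  refine h.ext h' (he (Ioo_subset_Icc_self hm)) ?_
  refine (h.pos _).unique ((h'.pos _).congr_of_eventuallyEq ?_)
  filter_upwards [Icc_mem_nhds hm.1 hm.2] with s hs using he hs

theorem IsSol.shift {e y : ℝ → ℝ × ℝ} (h : M.IsSol e y) (a : ℝ) :
    M.IsSol (fun t => e (t + a)) (fun t => y (t + a)) :=
  ⟨fun t => (h.pos (t + a)).comp_add_const t a, fun t => (h.vel (t + a)).comp_add_const t a,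
    fun _ => h.unit _⟩

theorem IsSol.contDiff {e y : ℝ → ℝ × ℝ} (h : M.IsSol e y) : ContDiff ℝ (⊤ : ℕ∞) e := by
  have key : ∀ n : ℕ, ContDiff ℝ n fun t => (e t, y t) := by
    intro n
    have hd : deriv (fun t => (e t, y t)) = fun t => M.field (e t, y t) :=
      funext fun t => (h.integralCurve t).deriv
    induction n with
    | zero =>
      exact contDiff_zero.2 (continuous_iff_continuousAt.2 fun t => (h.integralCurve t).continuousAt)
    | succ n ih =>
      push_cast
      rw [contDiff_succ_iff_deriv]
      refine ⟨fun t => (h.integralCurve t).differentiableAt, by simp, ?_⟩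
      rw [hd]
      exact (M.contDiff_field.of_le (by exact_mod_cast le_top)).comp ih
  exact contDiff_infty.2 fun n => (key n).fst

end TorusMetric

namespace TorusMetric

variable (M : TorusMetric)

theorem g_smul_smul (x v : ℝ × ℝ) (a : ℝ) : M.g x (a • v) (a • v) = a ^ 2 * M.g x v v := by
  simp only [← bilin_apply, map_smul, _root_.smul_apply, smul_eq_mul]
  ring

theorem g_nonneg (x v : ℝ × ℝ) : 0 ≤ M.g x v v := by
  by_cases h : v = 0
  · subst h
    simp [← bilin_apply]
  · exact (M.posdef x v h).le

theorem sqrt_g_smul (x v : ℝ × ℝ) {a : ℝ} (ha : 0 ≤ a) :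
    √(M.g x (a • v) (a • v)) = a * √(M.g x v v) := by
  rw [g_smul_smul, Real.sqrt_mul (sq_nonneg a), Real.sqrt_sq ha]

theorem continuous_speed {c : ℝ → ℝ × ℝ} (hc : ContDiff ℝ 1 c) :
    Continuous fun t => M.g (c t) (deriv c t) (deriv c t) :=
  M.contDiff_speed.continuous.comp (hc.continuous.prodMk (hc.continuous_deriv le_rfl))

theorem length_nonneg {c : ℝ → ℝ × ℝ} {a b : ℝ} (hab : a ≤ b) : 0 ≤ M.length c a b :=
  intervalIntegral.integral_nonneg hab fun _ _ => Real.sqrt_nonneg _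

theorem length_le {c : ℝ → ℝ × ℝ} {a b d : ℝ} (hab : a ≤ b) (hd : 0 ≤ d)
    (h : ∀ t, M.g (c t) (deriv c t) (deriv c t) ≤ d ^ 2) : M.length c a b ≤ d * (b - a) := by
  have := intervalIntegral.norm_integral_le_of_norm_le_const (a := a) (b := b) (C := d)
    (f := fun t => √(M.g (c t) (deriv c t) (deriv c t))) fun t _ => by
      rw [Real.norm_of_nonneg (Real.sqrt_nonneg _)]
      exact Real.sqrt_le_iff.2 ⟨hd, h t⟩
  rw [abs_of_nonneg (sub_nonneg.2 hab)] at this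
  exact (le_abs_self _).trans this

theorem bddBelow_lengths (x y : ℝ × ℝ) : BddBelow {L | ∃ c : ℝ → ℝ × ℝ, ContDiff ℝ 1 c ∧ c 0 = x ∧
    c 1 = y ∧ L = M.length c 0 1} := by
  refine ⟨0, ?_⟩
  rintro _ ⟨c, -, -, -, rfl⟩
  exact M.length_nonneg zero_le_one

theorem dist_le_length {c : ℝ → ℝ × ℝ} (hc : ContDiff ℝ 1 c) {a b : ℝ} (hab : a ≤ b) :
    M.dist (c a) (c b) ≤ M.length c a b := by
  have hd : ∀ t, deriv (fun t => c (a + (b - a) * t)) t = (b - a) • deriv c (a + (b - a) * t) := by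
    intro t
    have h1 := (hc.differentiable one_ne_zero (a + (b - a) * t)).hasDerivAt
    have h2 : HasDerivAt (fun t => a + (b - a) * t) (b - a) t := by
      simpa using ((hasDerivAt_id t).const_mul (b - a)).const_add a
    exact (h1.scomp t h2).deriv
  refine csInf_le (M.bddBelow_lengths _ _) ⟨fun t => c (a + (b - a) * t),
    hc.comp (contDiff_const.add (contDiff_const.mul contDiff_id)), by simp, by simp, ?_⟩
  simp only [length, hd, M.sqrt_g_smul _ _ (sub_nonneg.2 hab)]
  rw [intervalIntegral.integral_const_mul]
  have := intervalIntegral.smul_integral_comp_add_mul (a := 0) (b := 1)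
    (fun t => √(M.g (c t) (deriv c t) (deriv c t))) (b - a) a
  simp only [smul_eq_mul, mul_one, mul_zero, add_zero, add_sub_cancel] at this
  exact this.symm

theorem dist_nonneg (x y : ℝ × ℝ) : 0 ≤ M.dist x y := by
  refine Real.sInf_nonneg ?_
  rintro _ ⟨c, -, -, -, rfl⟩
  exact M.length_nonneg zero_le_one

theorem exists_dist_upper : ∃ u > 0, ∀ x y, M.dist x y ≤ u * ‖y - x‖ := by
  obtain ⟨u, hu, h⟩ := M.exists_upper
  refine ⟨√u, Real.sqrt_pos.2 hu, fun x y => ?_⟩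
  have hc : ContDiff ℝ 1 fun t : ℝ => x + t • (y - x) := by fun_prop
  have hd : ∀ t : ℝ, deriv (fun t : ℝ => x + t • (y - x)) t = y - x := by
    intro t
    simpa using (((hasDerivAt_id t).smul_const (y - x)).const_add x).deriv
  have h1 := M.dist_le_length hc zero_le_one
  simp only [zero_smul, add_zero, one_smul, add_sub_cancel] at h1
  refine h1.trans ?_
  refine (M.length_le (d := √u * ‖y - x‖) zero_le_one (by positivity) fun t => ?_).trans_eq (by ring)
  rw [hd, mul_pow, Real.sq_sqrt hu.le]
  exact ((le_abs_self _).trans (h _ _ _)).trans_eq (by ring)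

theorem dist_self (x : ℝ × ℝ) : M.dist x x = 0 := by
  obtain ⟨u, _, h⟩ := M.exists_dist_upper
  exact le_antisymm (by simpa using h x x) (M.dist_nonneg x x)

/-- Nearly minimizing curves can be parametrized with nearly constant speed. -/
theorem exists_curve_of_dist_lt {x y : ℝ × ℝ} {l τ : ℝ} (h : M.dist x y < l) (hτ : 0 < τ) :
    ∃ c : ℝ → ℝ × ℝ, ContDiff ℝ 1 c ∧ c 0 = x ∧ c τ = y ∧
      ∀ t, M.g (c t) (deriv c t) (deriv c t) ≤ (l / τ) ^ 2 := by
  have hne : {L | ∃ c : ℝ → ℝ × ℝ, ContDiff ℝ 1 c ∧ c 0 = x ∧ c 1 = y ∧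
      L = M.length c 0 1}.Nonempty :=
    ⟨_, fun t => x + t • (y - x), by fun_prop, by simp, by simp, rfl⟩
  obtain ⟨_, ⟨c, hc, hc0, hc1, rfl⟩, hL⟩ := exists_lt_of_csInf_lt hne h
  set δ := l - M.length c 0 1
  have hδ : 0 < δ := sub_pos.2 hL
  set v : ℝ → ℝ := fun t => √(M.g (c t) (deriv c t) (deriv c t)) + δ
  have hv : Continuous v := (M.continuous_speed hc).sqrt.add continuous_const
  have hvδ : ∀ t, δ ≤ v t := fun t => le_add_of_nonneg_left (Real.sqrt_nonneg _)
  have hvp : ∀ t, 0 < v t := fun t => hδ.trans_le (hvδ t)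
  set S : ℝ → ℝ := fun t => ∫ s in (0 : ℝ)..t, v s
  have hS : ∀ t, HasDerivAt S (v t) t := fun t => (hv.integral_hasStrictDerivAt 0 t).hasDerivAt
  have hS0 : S 0 = 0 := intervalIntegral.integral_same
  have hS1 : S 1 = l := by
    simp only [S, v]
    rw [intervalIntegral.integral_add ((M.continuous_speed hc).sqrt.intervalIntegrable _ _)
      (continuous_const.intervalIntegrable _ _)]
    simp only [intervalIntegral.integral_const, sub_zero, one_smul]
    exact add_sub_cancel _ _
  have hmono : Monotone fun t => S t - δ * t := by
    have hd : ∀ t, HasDerivAt (fun t => S t - δ * t) (v t - δ) t := fun t => by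
      have := (hS t).sub ((hasDerivAt_id t).const_mul δ)
      rw [mul_one] at this
      exact this
    refine monotone_of_deriv_nonneg (fun t => (hd t).differentiableAt) fun t => ?_
    rw [(hd t).deriv]
    linarith [hvδ t]
  have hcont : Continuous S := continuous_iff_continuousAt.2 fun t => (hS t).continuousAt
  have hsurj : Function.Surjective S := by
    refine hcont.surjective ?_ ?_
    · refine tendsto_atTop_mono' _ ?_ (tendsto_id.const_mul_atTop hδ)
      filter_upwards [eventually_ge_atTop 0] with t ht
      have := hmono ht
      simp [hS0] at this
      exact this
    · refine tendsto_atBot_mono' _ ?_ (tendsto_id.const_mul_atBot hδ)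
      filter_upwards [eventually_le_atBot 0] with t ht
      have := hmono ht
      simp [hS0] at this
      exact this
  have hstrict : StrictMono S := strictMono_of_deriv_pos fun t => by
    rw [(hS t).deriv]
    exact hvp t
  set F : ℝ ≃ₜ ℝ := (hstrict.orderIsoOfSurjective S hsurj).toHomeomorph
  have hF : (F : ℝ → ℝ) = S := rfl
  have hS1' : ContDiff ℝ 1 S := by
    rw [contDiff_one_iff_deriv]
    refine ⟨fun t => (hS t).differentiableAt, ?_⟩
    rwa [show deriv S = v from funext fun t => (hS t).deriv]
  have hFs : ContDiff ℝ 1 F.symm := F.contDiff_symm_deriv (f' := v) (fun t => (hvp t).ne') hS hS1'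
  have hFd : ∀ s, HasDerivAt F.symm (v (F.symm s))⁻¹ s := fun s =>
    HasDerivAt.of_local_left_inverse F.symm.continuous.continuousAt (hS _) (hvp _).ne'
      (Eventually.of_forall fun s => F.apply_symm_apply s)
  refine ⟨fun t => c (F.symm (l / τ * t)), hc.comp (hFs.comp (contDiff_const.mul contDiff_id)),
    ?_, ?_, fun t => ?_⟩
  · simp only [mul_zero]
    rw [show F.symm 0 = 0 from F.symm_apply_eq.2 hS0.symm, hc0]
  · simp only [div_mul_cancel₀ l hτ.ne']
    rw [show F.symm l = 1 from F.symm_apply_eq.2 hS1.symm, hc1]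
  · have h1 : HasDerivAt (fun t => F.symm (l / τ * t)) ((v (F.symm (l / τ * t)))⁻¹ * (l / τ)) t :=
      (hFd (l / τ * t)).comp t (by simpa using (hasDerivAt_id t).const_mul (l / τ))
    have h2 := ((hc.differentiable one_ne_zero (F.symm (l / τ * t))).hasDerivAt.scomp t h1).deriv
    simp only [Function.comp_def] at h2
    rw [h2, g_smul_smul]
    set s := F.symm (l / τ * t)
    have h3 : M.g (c s) (deriv c s) (deriv c s) ≤ v s ^ 2 := by
      rw [← Real.sq_sqrt (M.g_nonneg (c s) (deriv c s))]
      gcongr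
      exact le_add_of_nonneg_right hδ.le
    have h4 := hvp s
    calc _ ≤ ((v s)⁻¹ * (l / τ)) ^ 2 * v s ^ 2 := by gcongr
      _ = (l / τ) ^ 2 := by field_simp

theorem exists_dist_lower : ∃ l > 0, ∀ x y, l * ‖y - x‖ ≤ M.dist x y := by
  obtain ⟨l, hl, h⟩ := M.exists_lower
  refine ⟨√l, Real.sqrt_pos.2 hl, fun x y => le_of_forall_gt fun d hd => ?_⟩
  obtain ⟨d', hd1, hd2⟩ := exists_between hd
  refine lt_of_le_of_lt ?_ hd2
  have hd0 : 0 < d' := (M.dist_nonneg x y).trans_lt hd1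
  obtain ⟨c, hc, h0, h1, hb⟩ := M.exists_curve_of_dist_lt hd1 one_pos
  have h2 := norm_image_sub_le_of_norm_deriv_le_segment' (f := c) (f' := deriv c) (a := 0) (b := 1)
    (C := d' / √l) (fun t _ => (hc.differentiable one_ne_zero t).hasDerivAt.hasDerivWithinAt)
    (fun t _ => ?_) 1 (by simp)
  · rw [h0, h1, sub_zero, mul_one, le_div_iff₀ (Real.sqrt_pos.2 hl)] at h2
    linarith
  · rw [le_div_iff₀ (Real.sqrt_pos.2 hl)]
    refine abs_le_of_sq_le_sq' ?_ hd0.le |>.2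
    have h3 := (h (c t) (deriv c t)).trans (hb t)
    rw [mul_pow, Real.sq_sqrt hl.le]
    simpa [mul_comm] using h3

theorem eq_of_dist_le_zero {x y : ℝ × ℝ} (h : M.dist x y ≤ 0) : x = y := by
  obtain ⟨l, hl, hlow⟩ := M.exists_dist_lower
  have h1 := (hlow x y).trans h
  have h2 : ‖y - x‖ ≤ 0 := by
    by_contra! h3
    linarith [mul_pos hl h3]
  exact (sub_eq_zero.1 (norm_le_zero_iff.1 h2)).symm

theorem dist_add_lat (k : ℤ × ℤ) (x y : ℝ × ℝ) : M.dist (x + lat k) (y + lat k) = M.dist x y := by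
  have key : ∀ (k : ℤ × ℤ) (x y : ℝ × ℝ), M.dist (x + lat k) (y + lat k) ≤ M.dist x y := by
    refine fun k x y => le_of_forall_gt_imp_ge_of_dense fun d hd => ?_
    have hd0 : 0 < d := (M.dist_nonneg x y).trans_lt hd
    obtain ⟨c, hc, h0, h1, hb⟩ := M.exists_curve_of_dist_lt hd one_pos
    have := M.dist_le_length (c := fun t => c t + lat k) (hc.add contDiff_const) zero_le_one
    rw [h0, h1] at this
    refine this.trans ((M.length_le zero_le_one hd0.le fun t => ?_).trans_eq (by ring))
    rw [deriv_add_const, M.periodic]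
    simpa using hb t
  refine le_antisymm (key k x y) ?_
  simpa [lat_neg, add_assoc] using key (-k) (x + lat k) (y + lat k)

theorem dist_comm (x y : ℝ × ℝ) : M.dist x y = M.dist y x := by
  have key : ∀ x y : ℝ × ℝ, M.dist y x ≤ M.dist x y := by
    refine fun x y => le_of_forall_gt_imp_ge_of_dense fun d hd => ?_
    have hd0 : 0 < d := (M.dist_nonneg x y).trans_lt hd
    obtain ⟨c, hc, h0, h1, hb⟩ := M.exists_curve_of_dist_lt hd one_pos
    have := M.dist_le_length (c := fun t => c (1 - t)) (hc.comp (contDiff_const.sub contDiff_id))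
      zero_le_one
    simp only [sub_zero, sub_self] at this
    rw [h0, h1] at this
    refine this.trans ((M.length_le zero_le_one hd0.le fun t => ?_).trans_eq (by ring))
    have h2 : deriv (fun t => c (1 - t)) t = (-1 : ℝ) • deriv c (1 - t) := by
      rw [deriv_comp_const_sub]; simp
    rw [h2, g_smul_smul]
    simpa using hb (1 - t)
  exact le_antisymm (key _ _) (key _ _)

theorem dist_triangle (x y z : ℝ × ℝ) : M.dist x z ≤ M.dist x y + M.dist y z := by
  refine le_of_forall_pos_le_add fun ε hε => ?_
  obtain ⟨c₁, hc₁, h10, h11, hb₁⟩ := M.exists_curve_of_dist_lt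
    (lt_add_of_pos_right (M.dist x y) (half_pos hε)) one_pos
  obtain ⟨c₂, hc₂, h20, h21, hb₂⟩ := M.exists_curve_of_dist_lt
    (lt_add_of_pos_right (M.dist y z) (half_pos hε)) one_pos
  set φ := Real.smoothTransition
  have hφ : ContDiff ℝ 1 φ := Real.smoothTransition.contDiff (n := 1)
  set c : ℝ → ℝ × ℝ := fun t => c₁ (φ t) + c₂ (φ (t - 1)) - y
  have hc : ContDiff ℝ 1 c := ((hc₁.comp hφ).add
    (hc₂.comp (hφ.comp (contDiff_id.sub contDiff_const)))).sub contDiff_const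
  have hA : ∀ {c' : ℝ → ℝ × ℝ} {d : ℝ}, ContDiff ℝ 1 c' → 0 ≤ d →
      (∀ t, M.g (c' t) (deriv c' t) (deriv c' t) ≤ (d / 1) ^ 2) → M.length (c' ∘ φ) 0 1 ≤ d := by
    intro c' d hc' hd hb
    have h1 : ∀ t, √(M.g ((c' ∘ φ) t) (deriv (c' ∘ φ) t) (deriv (c' ∘ φ) t)) ≤ d * deriv φ t := by
      intro t
      have h2 : deriv (c' ∘ φ) t = deriv φ t • deriv c' (φ t) :=
        deriv.scomp t (hc'.differentiable one_ne_zero _) (hφ.differentiable one_ne_zero t)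
      have h3 : 0 ≤ deriv φ t := Real.smoothTransition.monotone.deriv_nonneg
      rw [h2, Function.comp_apply, sqrt_g_smul _ _ _ h3, mul_comm]
      gcongr
      exact Real.sqrt_le_iff.2 ⟨hd, by simpa using hb (φ t)⟩
    calc M.length (c' ∘ φ) 0 1 ≤ ∫ t in (0 : ℝ)..1, d * deriv φ t :=
          intervalIntegral.integral_mono_on zero_le_one
            ((M.continuous_speed (hc'.comp hφ)).sqrt.intervalIntegrable _ _)
            ((continuous_const.mul (hφ.continuous_deriv le_rfl)).intervalIntegrable _ _)
            fun t _ => h1 t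
      _ = d := by
          rw [intervalIntegral.integral_const_mul, intervalIntegral.integral_deriv_eq_sub
            (fun t _ => hφ.differentiable one_ne_zero t)
            ((hφ.continuous_deriv le_rfl).intervalIntegrable _ _)]
          simp [φ, Real.smoothTransition.zero, Real.smoothTransition.one]
  have e1 : M.length c 0 1 = M.length (c₁ ∘ φ) 0 1 := by
    have h1 : ∀ t < 1, c t = (c₁ ∘ φ) t := fun t ht => by
      simp only [c, φ, Function.comp_apply]
      rw [Real.smoothTransition.zero_of_nonpos (by linarith : t - 1 ≤ 0), h20]
      simp
    refine intervalIntegral.integral_congr_Ioo_of_le zero_le_one fun t ht => ?_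
    have h2 : c =ᶠ[𝓝 t] c₁ ∘ φ := by
      filter_upwards [Iio_mem_nhds (by simpa using ht.2 : t < 1)] with s hs using h1 s hs
    rw [h2.deriv_eq, h2.eq_of_nhds]
  have e2 : M.length c 1 2 = M.length (c₂ ∘ φ) 0 1 := by
    have h1 : ∀ t > 1, c t = (c₂ ∘ φ) (t - 1) := fun t ht => by
      simp only [c, φ, Function.comp_apply]
      rw [Real.smoothTransition.one_of_one_le ht.le, h11]
      simp
    have h3 : M.length (c₂ ∘ φ) 0 1 = ∫ t in (1 : ℝ)..2, √(M.g ((c₂ ∘ φ) (t - 1))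
        (deriv (c₂ ∘ φ) (t - 1)) (deriv (c₂ ∘ φ) (t - 1))) := by
      rw [intervalIntegral.integral_comp_sub_right
        (fun t => √(M.g ((c₂ ∘ φ) t) (deriv (c₂ ∘ φ) t) (deriv (c₂ ∘ φ) t)))]
      norm_num [length]
    rw [h3]
    refine intervalIntegral.integral_congr_Ioo_of_le one_le_two fun t ht => ?_
    have h2 : c =ᶠ[𝓝 t] fun t => (c₂ ∘ φ) (t - 1) := by
      filter_upwards [Ioi_mem_nhds (by simpa using ht.1 : 1 < t)] with s hs using h1 s hs
    rw [h2.deriv_eq, h2.eq_of_nhds, deriv_comp_sub_const]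
  have h0 : c 0 = x := by
    simp only [c, φ]
    rw [Real.smoothTransition.zero, Real.smoothTransition.zero_of_nonpos (by norm_num), h10, h20]
    simp
  have h2 : c 2 = z := by
    simp only [c, φ]
    rw [Real.smoothTransition.one_of_one_le (by norm_num),
      Real.smoothTransition.one_of_one_le (by norm_num), h11, h21]
    simp
  have h3 := M.dist_le_length hc (zero_le_two (α := ℝ))
  have h4 : M.length c 0 2 = M.length c 0 1 + M.length c 1 2 :=
    (intervalIntegral.integral_add_adjacent_intervals
      ((M.continuous_speed hc).sqrt.intervalIntegrable _ _)
      ((M.continuous_speed hc).sqrt.intervalIntegrable _ _)).symm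
  rw [h0, h2, h4, e1, e2] at h3
  have := hA hc₁ (by linarith [M.dist_nonneg x y]) hb₁
  have := hA hc₂ (by linarith [M.dist_nonneg y z]) hb₂
  linarith

end TorusMetric

namespace TorusMetric

variable (M : TorusMetric)

theorem abs_bilin_le {B : (ℝ × ℝ) →L[ℝ] (ℝ × ℝ) →L[ℝ] ℝ} {b : ℝ} (hB : ‖B‖ ≤ b) (v w : ℝ × ℝ) :
    |B v w| ≤ b * ‖v‖ * ‖w‖ :=
  (B.le_opNorm₂ v w).trans (by gcongr)

theorem exists_speed_bound : ∃ Y > 0, ∀ x v, M.g x v v = 1 → ‖v‖ ≤ Y := by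
  obtain ⟨l, hl, h⟩ := M.exists_lower
  refine ⟨√(1 / l), by positivity, fun x v hv => ?_⟩
  have h1 := h x v
  rw [hv] at h1
  refine Real.le_sqrt_of_sq_le ?_
  rw [le_div_iff₀ hl]
  linarith

/-- Second order expansion of the energy density. -/
theorem exists_density_bound : ∃ l > 0, ∃ C > 0, ∀ x φ v w : ℝ × ℝ, M.g x v v = 1 →
    1 + (fderiv ℝ M.bilin x φ v v + 2 * M.g x v w) + l * ‖w‖ ^ 2 - C * ‖φ‖ ^ 2 ≤
      M.g (x + φ) (v + w) (v + w) := by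
  obtain ⟨l, hl, hlow⟩ := M.exists_lower
  obtain ⟨K, hK, -, hK1, hK2⟩ := M.exists_fderiv_bound
  obtain ⟨Y, hY, hYb⟩ := M.exists_speed_bound
  refine ⟨l / 2, by positivity, K * Y ^ 2 + 2 * K ^ 2 * Y ^ 2 / l, by positivity,
    fun x φ v w hv => ?_⟩
  have hvY := hYb x v hv
  have h1 := hlow (x + φ) w
  have h2 := abs_bilin_le (hK1 x (x + φ)) v w
  have h3 := abs_bilin_le (hK2 x (x + φ)) v v
  have h4 := M.symm (x + φ) v w
  simp only [add_sub_cancel_left, _root_.sub_apply, bilin_apply] at h2 h3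
  have h5 : M.g (x + φ) (v + w) (v + w) =
      M.g (x + φ) v v + 2 * M.g (x + φ) v w + M.g (x + φ) w w := by
    simp only [← bilin_apply, map_add, _root_.add_apply] at h4 ⊢
    rw [← h4]
    ring
  have h6 : K * ‖φ‖ ^ 2 * ‖v‖ * ‖v‖ ≤ K * Y ^ 2 * ‖φ‖ ^ 2 := by
    rw [mul_assoc, ← pow_two, mul_assoc, mul_assoc, mul_comm (‖φ‖ ^ 2)]
    gcongr
  have h7 : 2 * (K * ‖φ‖ * ‖v‖ * ‖w‖) ≤ l / 2 * ‖w‖ ^ 2 + 2 * K ^ 2 * Y ^ 2 / l * ‖φ‖ ^ 2 := by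
    have h8 : 2 * (K * ‖φ‖ * ‖v‖ * ‖w‖) ≤ 2 * (K * ‖φ‖ * Y * ‖w‖) := by gcongr
    have h9 : l / 2 * ‖w‖ ^ 2 + 2 * K ^ 2 * Y ^ 2 / l * ‖φ‖ ^ 2 - 2 * (K * ‖φ‖ * Y * ‖w‖) =
        (l * ‖w‖ - 2 * K * Y * ‖φ‖) ^ 2 / (2 * l) := by
      field_simp
      ring
    have h10 : 0 ≤ (l * ‖w‖ - 2 * K * Y * ‖φ‖) ^ 2 / (2 * l) := by positivity
    linarith
  rw [abs_le] at h2 h3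
  linarith [h2.1, h3.1]

/-- The energy of a curve near a geodesic, to first order with a quadratic remainder. -/
theorem exists_energy_bound : ∃ τ > 0, ∃ κ > 0, ∀ {e y : ℝ → ℝ × ℝ}, M.IsSol e y →
    ∀ {c : ℝ → ℝ × ℝ}, ContDiff ℝ 1 c → ∀ {a b : ℝ}, a < b → b - a ≤ τ →
      (c a = e a ∨ c b = e b) → ∀ t ∈ Icc a b,
      (b - a) + (2 * M.g (e b) (y b) (c b - e b) - 2 * M.g (e a) (y a) (c a - e a)) +
        κ * ‖c t - e t‖ ^ 2 ≤ ∫ s in a..b, M.g (c s) (deriv c s) (deriv c s) := by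
  obtain ⟨l, hl, C, hC, hb⟩ := M.exists_density_bound
  set τ := min 1 (l / (2 * C))
  have hτ : 0 < τ := by positivity
  have hτ1 : C * τ * τ ≤ l / 2 := by
    have h1 : τ ≤ 1 := min_le_left _ _
    have h2 : τ ≤ l / (2 * C) := min_le_right _ _
    rw [le_div_iff₀ (by positivity)] at h2
    nlinarith
  refine ⟨τ, hτ, l / (2 * τ), by positivity, ?_⟩
  intro e y h c hc a b hab hbτ hend t ht
  have hce : Continuous e := h.contDiff.continuous
  have hcy : Continuous y := continuous_iff_continuousAt.2 fun t => (h.vel t).continuousAt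
  have hcd : Continuous (deriv c) := hc.continuous_deriv le_rfl
  have hφd : ∀ s, HasDerivAt (fun s => c s - e s) (deriv c s - y s) s := fun s =>
    (hc.differentiable one_ne_zero s).hasDerivAt.sub (h.pos s)
  set n : ℝ → ℝ := fun s => ‖deriv c s - y s‖
  have hn : Continuous n := (hcd.sub hcy).norm
  set I := ∫ s in a..b, n s
  have hI0 : 0 ≤ I := intervalIntegral.integral_nonneg hab.le fun _ _ => norm_nonneg _
  have hφI : ∀ s ∈ Icc a b, ‖c s - e s‖ ≤ I := by
    intro s hs
    have hsplit : ∫ s in a..b, n s = (∫ s in a..s, n s) + ∫ s in s..b, n s :=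
      (intervalIntegral.integral_add_adjacent_intervals (hn.intervalIntegrable _ _)
        (hn.intervalIntegrable _ _)).symm
    have hft : ∀ a b, a ≤ b → ‖(c b - e b) - (c a - e a)‖ ≤ ∫ s in a..b, n s := by
      intro a b hab
      rw [← intervalIntegral.integral_eq_sub_of_hasDerivAt (fun s _ => hφd s)
        ((hcd.sub hcy).intervalIntegrable _ _)]
      exact intervalIntegral.norm_integral_le_integral_norm hab
    have h1 := hft a s hs.1
    have h2 := hft s b hs.2
    have h3 : 0 ≤ ∫ s in a..s, n s :=
      intervalIntegral.integral_nonneg hs.1 fun _ _ => norm_nonneg _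
    have h4 : 0 ≤ ∫ s in s..b, n s :=
      intervalIntegral.integral_nonneg hs.2 fun _ _ => norm_nonneg _
    rcases hend with h0 | h0
    · rw [h0, sub_self, sub_zero] at h1
      linarith
    · rw [h0, sub_self, zero_sub, norm_neg] at h2
      linarith
  set D : ℝ → ℝ := fun s => fderiv ℝ M.bilin (e s) (c s - e s) (y s) (y s) +
    2 * M.g (e s) (y s) (deriv c s - y s)
  have hD : ∀ s, HasDerivAt (fun s => 2 * M.g (e s) (y s) (c s - e s)) (D s) s := by
    intro s
    have h1 := (M.hasDerivAt_bilin (h.pos s) (h.vel s) (hφd s)).const_mul 2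
    rw [bilin_accel_apply] at h1
    convert! h1 using 1
    simp only [D]
    ring
  have hDc : Continuous D := by
    have h1 := M.contDiff_fderiv_bilin.continuous.comp hce
    have h2 := M.contDiff_bilin.continuous.comp hce
    exact (((h1.clm_apply (hc.continuous.sub hce)).clm_apply hcy).clm_apply hcy).add
      (continuous_const.mul ((h2.clm_apply hcy).clm_apply (hcd.sub hcy)))
  have hG := M.continuous_speed hc
  have hlow : ∫ s in a..b, ((1 - C * I ^ 2) + D s + l * n s ^ 2) ≤
      ∫ s in a..b, M.g (c s) (deriv c s) (deriv c s) := by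
    refine intervalIntegral.integral_mono_on hab.le (((continuous_const.add hDc).add
      (continuous_const.mul (hn.pow 2))).intervalIntegrable _ _) (hG.intervalIntegrable _ _)
      fun s hs => ?_
    have h1 := hb (e s) (c s - e s) (y s) (deriv c s - y s) (h.unit s)
    simp only [add_sub_cancel] at h1
    have h2 : C * ‖c s - e s‖ ^ 2 ≤ C * I ^ 2 := by
      have := hφI s hs
      gcongr
    simp only [D, n]
    linarith
  have i1 : IntervalIntegrable (fun s => (1 - C * I ^ 2) + D s) MeasureTheory.volume a b :=
    (continuous_const.add hDc).intervalIntegrable _ _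
  have i2 : IntervalIntegrable (fun s => l * n s ^ 2) MeasureTheory.volume a b :=
    (continuous_const.mul (hn.pow 2)).intervalIntegrable _ _
  rw [intervalIntegral.integral_add i1 i2,
    intervalIntegral.integral_add (continuous_const.intervalIntegrable _ _)
    (hDc.intervalIntegrable _ _), intervalIntegral.integral_const_mul,
    intervalIntegral.integral_const, smul_eq_mul,
    intervalIntegral.integral_eq_sub_of_hasDerivAt (fun s _ => hD s) (hDc.intervalIntegrable _ _)]
    at hlow
  have hCS : I ^ 2 ≤ (b - a) * ∫ s in a..b, n s ^ 2 := by
    have h1 : 0 ≤ ∫ s in a..b, ((b - a) * n s - I) ^ 2 :=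
      intervalIntegral.integral_nonneg hab.le fun _ _ => sq_nonneg _
    have h2 : ∀ s, ((b - a) * n s - I) ^ 2 =
        (b - a) ^ 2 * n s ^ 2 - (2 * (b - a) * I) * n s + I ^ 2 := fun s => by ring
    simp only [h2] at h1
    have i3 : IntervalIntegrable (fun s => (b - a) ^ 2 * n s ^ 2) MeasureTheory.volume a b :=
      (continuous_const.mul (hn.pow 2)).intervalIntegrable _ _
    have i4 : IntervalIntegrable (fun s => 2 * (b - a) * I * n s) MeasureTheory.volume a b :=
      (continuous_const.mul hn).intervalIntegrable _ _
    rw [intervalIntegral.integral_add (i3.sub i4) (continuous_const.intervalIntegrable _ _),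
      intervalIntegral.integral_sub i3 i4, intervalIntegral.integral_const_mul,
      intervalIntegral.integral_const_mul, intervalIntegral.integral_const, smul_eq_mul] at h1
    have h3 : 0 ≤ (b - a) * ((b - a) * (∫ s in a..b, n s ^ 2) - I ^ 2) := by
      simp only [I] at h1 ⊢
      linarith
    have h4 := nonneg_of_mul_nonneg_right h3 (sub_pos.2 hab)
    linarith
  have h5 : (b - a) * (C * I ^ 2) + l / (2 * τ) * ‖c t - e t‖ ^ 2 ≤
      l * ∫ s in a..b, n s ^ 2 := by
    have h6 := hφI t ht
    have h7 : l / (2 * τ) * ‖c t - e t‖ ^ 2 ≤ l / (2 * τ) * I ^ 2 := by gcongr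
    have h8 : I ^ 2 ≤ τ * ∫ s in a..b, n s ^ 2 := hCS.trans (by
      gcongr
      exact intervalIntegral.integral_nonneg hab.le fun _ _ => sq_nonneg _)
    have h9 : (b - a) * (C * I ^ 2) ≤ τ * (C * I ^ 2) := by gcongr
    have h10 : τ * (C * I ^ 2) ≤ l / (2 * τ) * I ^ 2 := by
      rw [← mul_assoc]
      gcongr
      rw [le_div_iff₀ (by positivity)]
      linarith
    have h11 : l / τ * I ^ 2 ≤ l * ∫ s in a..b, n s ^ 2 := by
      rw [div_mul_eq_mul_div, div_le_iff₀ hτ, mul_assoc, mul_comm _ τ]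
      gcongr
    have h12 : l / (2 * τ) * I ^ 2 + l / (2 * τ) * I ^ 2 = l / τ * I ^ 2 := by
      field_simp
      ring
    linarith
  linarith

/-- Geodesics realize the distance at small scales, and do so uniquely. -/
theorem exists_local_minimality : ∃ τ > 0, (∀ {e y : ℝ → ℝ × ℝ}, M.IsSol e y → ∀ s t, s ≤ t →
    t - s ≤ τ → M.dist (e s) (e t) = t - s) ∧
    (∀ {e y : ℝ → ℝ × ℝ}, M.IsSol e y → ∀ t s m, 0 ≤ s → s ≤ t → t ≤ τ →
      M.dist (e 0) m ≤ s → M.dist m (e t) ≤ t - s → m = e s) := by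
  obtain ⟨τ, hτ, κ, hκ, H⟩ := M.exists_energy_bound
  refine ⟨τ, hτ, ?_, ?_⟩
  · intro e y h s t hst htτ
    have hde : deriv e = y := funext fun t => (h.pos t).deriv
    have he1 : ContDiff ℝ 1 e := h.contDiff.of_le (by exact_mod_cast le_top)
    refine le_antisymm ?_ ?_
    · have := M.dist_le_length he1 hst
      simpa [length, hde, h.unit] using this
    · rcases hst.eq_or_lt with rfl | hlt
      · simpa using M.dist_nonneg _ _
      by_contra! hd
      obtain ⟨d, hd1, hd2⟩ := exists_between hd
      have hd0 : 0 < d := (M.dist_nonneg _ _).trans_lt hd1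
      have hp : 0 < t - s := sub_pos.2 hlt
      obtain ⟨c, hc, hc0, hc1, hcb⟩ := M.exists_curve_of_dist_lt hd1 hp
      have h' := h.shift s
      have h1 := H h' hc hp (by simpa using htτ) (.inl (by simpa using hc0)) 0 ⟨le_rfl, hp.le⟩
      have h2 : ∫ r in 0..(t - s), M.g (c r) (deriv c r) (deriv c r) ≤
          ∫ _ in 0..(t - s), (d / (t - s)) ^ 2 :=
        intervalIntegral.integral_mono_on hp.le ((M.continuous_speed hc).intervalIntegrable _ _)
          (continuous_const.intervalIntegrable _ _) fun r _ => hcb r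
      simp only [sub_add_cancel, zero_add, hc0, hc1, sub_self, ← bilin_apply, map_zero, mul_zero,
        norm_zero, sub_zero, intervalIntegral.integral_const, smul_eq_mul] at h1 h2
      have h3 : (t - s) * (d / (t - s)) ^ 2 < t - s := by
        have h4 : d / (t - s) < 1 := (div_lt_one hp).2 hd2
        exact mul_lt_of_lt_one_right hp (pow_lt_one₀ (by positivity) h4 two_ne_zero)
      linarith
  · intro e y h t s m hs hst htτ h1 h2
    rcases hs.eq_or_lt with rfl | hs0
    · exact (M.eq_of_dist_le_zero h1).symm
    rcases hst.eq_or_lt with rfl | hst0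
    · exact M.eq_of_dist_le_zero (by simpa using h2)
    have hts : 0 < t - s := sub_pos.2 hst0
    have key : ∀ ε > 0, κ * ‖m - e s‖ ^ 2 ≤
        (s * ((s + ε) / s) ^ 2 + (t - s) * ((t - s + ε) / (t - s)) ^ 2) - t := by
      intro ε hε
      obtain ⟨c, hc, hc0, hc1, hcb⟩ := M.exists_curve_of_dist_lt (h1.trans_lt
        (lt_add_of_pos_right s hε)) hs0
      obtain ⟨c', hc', hc0', hc1', hcb'⟩ := M.exists_curve_of_dist_lt (h2.trans_lt
        (lt_add_of_pos_right (t - s) hε)) hts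
      have h3 := H h hc hs0 (by linarith) (.inl hc0) s ⟨hs0.le, le_rfl⟩
      have h4 := H (h.shift s) hc' hts (by linarith) (.inr (by simpa using hc1')) 0 ⟨le_rfl, hts.le⟩
      have h5 : ∫ r in 0..s, M.g (c r) (deriv c r) (deriv c r) ≤
          ∫ _ in 0..s, ((s + ε) / s) ^ 2 :=
        intervalIntegral.integral_mono_on hs ((M.continuous_speed hc).intervalIntegrable _ _)
          (continuous_const.intervalIntegrable _ _) fun r _ => hcb r
      have h6 : ∫ r in 0..(t - s), M.g (c' r) (deriv c' r) (deriv c' r) ≤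
          ∫ _ in 0..(t - s), ((t - s + ε) / (t - s)) ^ 2 :=
        intervalIntegral.integral_mono_on hts.le ((M.continuous_speed hc').intervalIntegrable _ _)
          (continuous_const.intervalIntegrable _ _) fun r _ => hcb' r
      simp only [sub_add_cancel, zero_add, hc0, hc1, hc0', hc1', sub_self, ← bilin_apply, map_zero,
        mul_zero, sub_zero, intervalIntegral.integral_const, smul_eq_mul] at h3 h4 h5 h6
      have h7 : 0 ≤ κ * ‖m - e s‖ ^ 2 := by positivity
      linarith
    have hlim : Tendsto (fun ε : ℝ => (s * ((s + ε) / s) ^ 2 +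
        (t - s) * ((t - s + ε) / (t - s)) ^ 2) - t) (𝓝[>] 0) (𝓝 0) := by
      have : Continuous (fun ε : ℝ => (s * ((s + ε) / s) ^ 2 +
        (t - s) * ((t - s + ε) / (t - s)) ^ 2) - t) := by fun_prop
      have h8 := (this.tendsto 0).mono_left (nhdsWithin_le_nhds (s := Ioi 0))
      convert! h8 using 2
      field_simp
      ring
    have h9 := ge_of_tendsto hlim (eventually_nhdsWithin_of_forall fun ε hε => key ε hε)
    have h10 : ‖m - e s‖ ^ 2 ≤ 0 := by
      by_contra! h11
      linarith [mul_pos hκ h11]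
    have h12 : ‖m - e s‖ = 0 := by nlinarith [norm_nonneg (m - e s)]
    exact sub_eq_zero.1 (norm_eq_zero.1 h12)

theorem IsSol.isGeodesic {M : TorusMetric} {e y : ℝ → ℝ × ℝ} (h : M.IsSol e y) :
    M.IsGeodesic e := by
  obtain ⟨τ, hτ, H, -⟩ := M.exists_local_minimality
  have hde : deriv e = y := funext fun t => (h.pos t).deriv
  refine ⟨h.contDiff, fun t => by rw [hde]; exact h.unit t, fun t => ⟨τ / 2, by positivity, ?_⟩⟩
  intro s₁ s₂ h1 h2 h3
  rw [H h s₁ s₂ h2 (by linarith)]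
  simp [length, hde, h.unit]

end TorusMetric

namespace TorusMetric

variable (M : TorusMetric)

open scoped NNReal in
/-- The exponential map of the geodesic flow at small times, in the velocity variable, is close
to a multiple of the identity; hence nearby points are joined by short geodesics. -/
theorem exists_isSol_between {τ₀ : ℝ} (hτ₀ : 0 < τ₀) : ∃ ρ > 0, ∀ p q : ℝ × ℝ, p ≠ q →
    ‖q - p‖ ≤ ρ → ∃ (e y : ℝ → ℝ × ℝ) (T : ℝ), M.IsSol e y ∧ 0 < T ∧ T ≤ τ₀ ∧ e 0 = p ∧ e T = q := by
  obtain ⟨K, B, hB, hL, hb⟩ := M.exists_field_bound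
  obtain ⟨u, hu, hup⟩ := M.exists_upper
  choose z hz0 hz using M.exists_integralCurve
  set V := √(1 / u)
  have hV : 0 < V := by positivity
  have hV1 : ∀ p v : ℝ × ℝ, ‖v‖ ≤ V → M.g p v v ≤ 1 := by
    intro p v hv
    have h1 := (le_abs_self _).trans (hup p v v)
    have h2 : ‖v‖ ^ 2 ≤ V ^ 2 := by gcongr
    rw [Real.sq_sqrt (by positivity), le_div_iff₀ hu] at h2
    nlinarith
  set L := K * Real.exp K + 1
  have hL0 : 0 < L := by positivity
  set τ := min τ₀ (min 1 (1 / (2 * L)))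
  have hτ : 0 < τ := by positivity
  have hτ1 : τ ≤ 1 := (min_le_right _ _).trans (min_le_left _ _)
  have hτL : K * Real.exp K * τ ≤ 1 / 2 := by
    have h1 : τ ≤ 1 / (2 * L) := (min_le_right _ _).trans (min_le_right _ _)
    rw [le_div_iff₀ (by positivity)] at h1
    have h2 : K * Real.exp K * τ ≤ L * τ := by
      gcongr
      simp [L]
    linarith
  refine ⟨τ * V / 2, by positivity, fun p q hpq hqp => ?_⟩
  have hspeed : ∀ v, ‖v‖ ≤ V → ∀ t, M.g (z (p, v) t).1 (z (p, v) t).2 (z (p, v) t).2 = M.g p v v := by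
    intro v hv t
    rw [M.speed_integralCurve (hz (p, v)) t, hz0]
  have hfst : ∀ v, ‖v‖ ≤ V → ∀ t, HasDerivAt (fun t => (z (p, v) t).1) (z (p, v) t).2 t := by
    intro v hv t
    have h1 := (hz (p, v) t).fst
    rwa [M.field_eq (x := (z (p, v) t).1) (v := (z (p, v) t).2)
      (by rw [hspeed v hv]; linarith [hV1 p v hv])] at h1
  have hsnd : ∀ v t, HasDerivAt (fun t => (z (p, v) t).2) (M.field (z (p, v) t)).2 t :=
    fun v t => (hz (p, v) t).snd
  have hcontr : ∀ v w, ‖v‖ ≤ V → ‖w‖ ≤ V →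
      ‖((z (p, v) τ).1 - (z (p, w) τ).1) - τ • (v - w)‖ ≤ 1 / 2 * ‖v - w‖ * τ := by
    intro v w hv hw
    have hG : ∀ t ∈ Icc 0 τ, ‖z (p, v) t - z (p, w) t‖ ≤ ‖v - w‖ * Real.exp K := by
      intro t ht
      have h1 := dist_le_of_trajectories_ODE (v := fun _ => M.field) (K := K) (f := z (p, v))
        (g := z (p, w)) (a := 0) (b := τ) (δ := ‖v - w‖) (fun _ => hL)
        (fun t _ => (hz _ t).continuousAt.continuousWithinAt)
        (fun t _ => (hz _ t).hasDerivWithinAt)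
        (fun t _ => (hz _ t).continuousAt.continuousWithinAt)
        (fun t _ => (hz _ t).hasDerivWithinAt) (by rw [hz0, hz0, dist_eq_norm]; simp) t ht
      rw [dist_eq_norm] at h1
      refine h1.trans ?_
      gcongr
      exact mul_le_of_le_one_right K.2 (by linarith [ht.2])
    have hD : ∀ t ∈ Icc 0 τ, ‖((z (p, v) t).2 - (z (p, w) t).2) - (v - w)‖ ≤ 1 / 2 * ‖v - w‖ := by
      intro t ht
      have h1 := norm_image_sub_le_of_norm_deriv_le_segment'
        (f := fun t => (z (p, v) t).2 - (z (p, w) t).2) (a := 0) (b := τ)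
        (C := K * (‖v - w‖ * Real.exp K))
        (fun t _ => ((hsnd v t).sub (hsnd w t)).hasDerivWithinAt) ?_ t ht
      · simp only [hz0, sub_zero] at h1
        refine h1.trans ?_
        calc K * (‖v - w‖ * Real.exp K) * t ≤ K * (‖v - w‖ * Real.exp K) * τ := by
              gcongr; exact ht.2
          _ = K * Real.exp K * τ * ‖v - w‖ := by ring
          _ ≤ _ := by gcongr
      · intro t ht
        have h2 := hL.dist_le_mul (z (p, v) t) (z (p, w) t)
        rw [dist_eq_norm, dist_eq_norm] at h2
        rw [← Prod.snd_sub]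
        refine (norm_snd_le _).trans (h2.trans ?_)
        gcongr
        exact hG t (Ico_subset_Icc_self ht)
    have h1 := norm_image_sub_le_of_norm_deriv_le_segment'
      (f := fun t => ((z (p, v) t).1 - (z (p, w) t).1) - t • (v - w)) (a := 0) (b := τ)
      (C := 1 / 2 * ‖v - w‖)
      (fun t _ => (((hfst v hv t).sub (hfst w hw t)).sub
        ((hasDerivAt_id t).smul_const (v - w))).hasDerivWithinAt) ?_ τ ⟨hτ.le, le_rfl⟩
    · simpa [hz0] using h1
    · intro t ht
      simpa using hD t (Ico_subset_Icc_self ht)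
  set Ψ : ℝ × ℝ → ℝ × ℝ := fun v => v - τ⁻¹ • ((z (p, v) τ).1 - q)
  have hΨ : ∀ v w, ‖v‖ ≤ V → ‖w‖ ≤ V → ‖Ψ v - Ψ w‖ ≤ 1 / 2 * ‖v - w‖ := by
    intro v w hv hw
    have h1 : Ψ v - Ψ w = -(τ⁻¹ • (((z (p, v) τ).1 - (z (p, w) τ).1) - τ • (v - w))) := by
      simp only [Ψ]
      rw [smul_sub τ⁻¹ _ (τ • (v - w)), smul_smul, inv_mul_cancel₀ hτ.ne', one_smul, smul_sub,
        smul_sub, smul_sub]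
      abel
    rw [h1, norm_neg, norm_smul, norm_inv, Real.norm_of_nonneg hτ.le, inv_mul_le_iff₀ hτ]
    linarith [hcontr v w hv hw]
  have hconst : (z (p, 0) τ).1 = p := by
    have h0 : ∀ t, (z (p, 0) t).2 = 0 := by
      intro t
      by_contra hne
      have h1 := M.posdef (z (p, 0) t).1 _ hne
      rw [hspeed 0 (by simpa using hV.le)] at h1
      simp [← bilin_apply] at h1
    have h1 := is_const_of_deriv_eq_zero (f := fun t => (z (p, 0) t).1)
      (fun t => (hfst 0 (by simpa using hV.le) t).differentiableAt)
      (fun t => by rw [(hfst 0 (by simpa using hV.le) t).deriv, h0]) τ 0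
    simpa [hz0] using h1
  have hΨ0 : ‖Ψ 0‖ ≤ V / 2 := by
    simp only [Ψ, hconst, zero_sub, norm_neg]
    rw [norm_smul, norm_inv, Real.norm_of_nonneg hτ.le, inv_mul_le_iff₀ hτ, norm_sub_rev]
    linarith
  have hmaps : MapsTo Ψ (Metric.closedBall 0 V) (Metric.closedBall 0 V) := by
    intro v hv
    rw [mem_closedBall_zero_iff] at hv ⊢
    have h1 := hΨ v 0 hv (by simpa using hV.le)
    have h2 := norm_add_le (Ψ v - Ψ 0) (Ψ 0)
    rw [sub_add_cancel] at h2
    rw [sub_zero] at h1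
    linarith
  have hc : ContractingWith (1 / 2) (hmaps.restrict Ψ _ _) := by
    refine ⟨by rw [← NNReal.coe_lt_coe]; norm_num, LipschitzWith.of_dist_le_mul fun v w => ?_⟩
    have := hΨ v w (mem_closedBall_zero_iff.1 v.2) (mem_closedBall_zero_iff.1 w.2)
    simpa [Subtype.dist_eq, dist_eq_norm] using this
  obtain ⟨v, hv, hfix, -⟩ := hc.exists_fixedPoint' Metric.isClosed_closedBall.isComplete hmaps
    (x := 0) (by simpa using hV.le) (edist_ne_top _ _)
  rw [mem_closedBall_zero_iff] at hv
  have hq : (z (p, v) τ).1 = q := by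
    have h1 : v - τ⁻¹ • ((z (p, v) τ).1 - q) = v := hfix
    simpa [hτ.ne', sub_eq_zero] using h1
  have hv0 : v ≠ 0 := by
    rintro rfl
    exact hpq (hconst.symm.trans hq)
  have hg := M.posdef p v hv0
  set a := √(M.g p v v)
  have ha : 0 < a := Real.sqrt_pos.2 hg
  have ha2 : a ^ 2 = M.g p v v := Real.sq_sqrt hg.le
  have ha1 : a ≤ 1 := Real.sqrt_le_one.2 (hV1 p v hv)
  refine ⟨_, _, a * τ, isSol_of_integralCurve (hz (p, v)) ha.ne' (by rw [ha2]; linarith [hV1 p v hv])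
    (by rw [hz0, ha2]), by positivity, ?_, by simp [hz0], by simp [ha.ne', hq]⟩
  exact (mul_le_of_le_one_left hτ.le ha1).trans (min_le_left _ _)

/-- `γ` realizes the distance between any two of its points on `[a, b]`. -/
def IsSeg (γ : ℝ → ℝ × ℝ) (a b : ℝ) : Prop :=
  ∀ s t, a ≤ s → s ≤ t → t ≤ b → M.dist (γ s) (γ t) = t - s

variable {M} in
theorem IsSeg.mono {γ : ℝ → ℝ × ℝ} {a b a' b' : ℝ} (h : M.IsSeg γ a b) (ha : a ≤ a') (hb : b' ≤ b) :
    M.IsSeg γ a' b' := fun s t hs hst ht => h s t (ha.trans hs) hst (ht.trans hb)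

theorem exists_isSol_of_isSeg : ∃ ρ > 0, ∀ {γ : ℝ → ℝ × ℝ} {a b : ℝ}, M.IsSeg γ a b → a < b →
    b - a ≤ ρ → ∃ e y, M.IsSol e y ∧ EqOn γ e (Icc a b) := by
  obtain ⟨τ, hτ, hE, hU⟩ := M.exists_local_minimality
  obtain ⟨ρ, hρ, hbvp⟩ := M.exists_isSol_between hτ
  obtain ⟨l, hl, hlow⟩ := M.exists_dist_lower
  refine ⟨l * ρ, by positivity, fun {γ a b} h hab hle => ?_⟩
  have hd : M.dist (γ a) (γ b) = b - a := h a b le_rfl hab.le le_rfl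
  have hne : γ a ≠ γ b := by
    intro h0
    rw [h0, dist_self] at hd
    linarith
  have hn : ‖γ b - γ a‖ ≤ ρ := by
    have h1 := (hlow (γ a) (γ b)).trans (hd.le.trans hle)
    exact le_of_mul_le_mul_left h1 hl
  obtain ⟨e, y, T, he, hT, hTτ, he0, heT⟩ := hbvp _ _ hne hn
  have h1 := hE he 0 T hT.le (by simpa using hTτ)
  rw [he0, heT, hd, sub_zero] at h1
  refine ⟨_, _, he.shift (-a), fun t ht => ?_⟩
  refine hU he T (t + -a) (γ t) (by linarith [ht.1]) (by linarith [ht.2]) hTτ ?_ ?_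
  · rw [he0, h a t le_rfl ht.1 ht.2]
    linarith
  · rw [heT, h t b ht.1 ht.2 le_rfl]
    linarith

theorem exists_isSol_of_isSeg_Ici {γ : ℝ → ℝ × ℝ} {a : ℝ} (h : ∀ b, M.IsSeg γ a b) :
    ∃ e y, M.IsSol e y ∧ EqOn γ e (Ici a) := by
  obtain ⟨ρ, hρ, H⟩ := M.exists_isSol_of_isSeg
  have key : ∀ n : ℕ, ∃ e y, M.IsSol e y ∧ EqOn γ e (Icc (a + n * (ρ / 2)) (a + (n + 2) * (ρ / 2))) := by
    intro n
    refine H ((h (a + (n + 2) * (ρ / 2))).mono ?_ le_rfl) (by linarith) (by linarith)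
    have : 0 ≤ n * (ρ / 2) := by positivity
    linarith
  choose e y he heq using key
  have hcst : ∀ n, e n = e 0 := by
    intro n
    induction n with
    | zero => rfl
    | succ n ih =>
      rw [← ih]
      refine (he _).ext_of_eqOn (he n) (a := a + (n + 1) * (ρ / 2)) (b := a + (n + 2) * (ρ / 2))
        (by linarith) fun t ht => ?_
      rw [← heq (n + 1) ⟨by push_cast; exact ht.1, by push_cast; linarith [ht.2]⟩,
        heq n ⟨by linarith [ht.1], ht.2⟩]
  refine ⟨e 0, y 0, he 0, fun t ht => ?_⟩
  have h0 : 0 ≤ (t - a) / (ρ / 2) := div_nonneg (sub_nonneg.2 ht) (by positivity)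
  set n := ⌊(t - a) / (ρ / 2)⌋₊
  have h1 : (n : ℝ) ≤ (t - a) / (ρ / 2) := Nat.floor_le h0
  have h2 : (t - a) / (ρ / 2) < n + 1 := Nat.lt_floor_add_one _
  rw [le_div_iff₀ (by positivity)] at h1
  rw [div_lt_iff₀ (by positivity)] at h2
  rw [← hcst n]
  exact heq n ⟨by linarith, by linarith⟩

end TorusMetric

/-- Pointwise bounded sequences of curves have pointwise limits along an ultrafilter. -/
theorem exists_pointwise_limit {c : ℕ → ℝ → ℝ × ℝ} (h : ∀ t, ∃ R, ∀ᶠ n in atTop, ‖c n t‖ ≤ R) :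
    ∃ γ : ℝ → ℝ × ℝ, ∀ t, Tendsto (fun n => c n t) (hyperfilter ℕ : Filter ℕ) (𝓝 (γ t)) := by
  have key : ∀ t, ∃ p, Tendsto (fun n => c n t) (hyperfilter ℕ : Filter ℕ) (𝓝 p) := by
    intro t
    obtain ⟨R, hR⟩ := h t
    obtain ⟨p, -, hp⟩ := (isCompact_closedBall (0 : ℝ × ℝ) R).ultrafilter_le_nhds
      ((hyperfilter ℕ).map fun n => c n t) (by
        rw [le_principal_iff]
        refine Ultrafilter.mem_map.2 (mem_of_superset (Nat.hyperfilter_le_atTop hR) ?_)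
        exact fun n hn => mem_closedBall_zero_iff.2 hn)
    exact ⟨p, hp⟩
  choose γ hγ using key
  exact ⟨γ, hγ⟩

theorem tendsto_uncurried {F : ℝ × ℝ → ℝ × ℝ → ℝ}
    (hF : Continuous fun p : (ℝ × ℝ) × (ℝ × ℝ) => F p.1 p.2) {α : Type*} {f : Filter α}
    {c c' : α → ℝ × ℝ} {p q : ℝ × ℝ} (h : Tendsto c f (𝓝 p)) (h' : Tendsto c' f (𝓝 q)) :
    Tendsto (fun a => F (c a) (c' a)) f (𝓝 (F p q)) :=
  (hF.tendsto (p, q)).comp (h.prodMk_nhds h')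

namespace TorusMetric

variable (M : TorusMetric)

theorem continuous_dist : Continuous fun p : (ℝ × ℝ) × (ℝ × ℝ) => M.dist p.1 p.2 := by
  obtain ⟨u, hu, h⟩ := M.exists_dist_upper
  have key : ∀ p q : (ℝ × ℝ) × (ℝ × ℝ), M.dist p.1 p.2 - M.dist q.1 q.2 ≤ 2 * u * ‖p - q‖ := by
    intro p q
    have h1 := M.dist_triangle p.1 q.1 p.2
    have h2 := M.dist_triangle q.1 q.2 p.2
    have h3 := h q.1 p.1
    have h4 := h q.2 p.2
    rw [M.dist_comm] at h3
    have h5 : u * ‖p.1 - q.1‖ ≤ u * ‖p - q‖ := by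
      gcongr
      exact norm_fst_le (p - q)
    have h6 : u * ‖p.2 - q.2‖ ≤ u * ‖p - q‖ := by
      gcongr
      exact norm_snd_le (p - q)
    linarith
  refine (LipschitzWith.of_dist_le_mul (K := Real.toNNReal (2 * u)) fun p q => ?_).continuous
  rw [Real.dist_eq, dist_eq_norm, Real.coe_toNNReal _ (by positivity), abs_le]
  refine ⟨?_, key p q⟩
  have := key q p
  rw [norm_sub_rev] at this
  linarith

theorem tendsto_dist {α : Type*} {f : Filter α} {c c' : α → ℝ × ℝ} {p q : ℝ × ℝ}
    (h : Tendsto c f (𝓝 p)) (h' : Tendsto c' f (𝓝 q)) :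
    Tendsto (fun a => M.dist (c a) (c' a)) f (𝓝 (M.dist p q)) :=
  tendsto_uncurried M.continuous_dist h h'

/-- Any two points are joined by a minimizing segment. -/
theorem exists_isSeg (x y : ℝ × ℝ) :
    ∃ γ : ℝ → ℝ × ℝ, γ 0 = x ∧ γ (M.dist x y) = y ∧ M.IsSeg γ 0 (M.dist x y) := by
  obtain ⟨L, hLdef⟩ : ∃ L, L = M.dist x y := ⟨_, rfl⟩
  rw [← hLdef]
  have hL0 := M.dist_nonneg x y
  rw [← hLdef] at hL0
  rcases hL0.eq_or_lt with h0 | hL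
  · rw [hLdef] at h0
    have hxy := M.eq_of_dist_le_zero h0.ge
    refine ⟨fun _ => x, rfl, hxy, fun s t hs hst ht => ?_⟩
    rw [dist_self]
    linarith
  have hpos : ∀ n : ℕ, 0 < 1 / ((n : ℝ) + 1) := fun n => Nat.one_div_pos_of_nat
  choose c hc hc0 hc1 hcb using fun n : ℕ => M.exists_curve_of_dist_lt
    (hLdef ▸ lt_add_of_pos_right L (hpos n) : M.dist x y < L + 1 / ((n : ℝ) + 1)) hL
  have hlip : ∀ n s t, s ≤ t → M.dist (c n s) (c n t) ≤ (L + 1 / ((n : ℝ) + 1)) / L * (t - s) := by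
    intro n s t hst
    have := hpos n
    exact (M.dist_le_length (hc n) hst).trans (M.length_le hst (by positivity) (hcb n))
  obtain ⟨l, hl, hlow⟩ := M.exists_dist_lower
  have hbd : ∀ t, ∃ R, ∀ᶠ n in atTop, ‖c n t‖ ≤ R := by
    intro t
    refine ⟨‖x‖ + (L + 1) / L * |t| / l, Eventually.of_forall fun n => ?_⟩
    have h1 : M.dist x (c n t) ≤ (L + 1) / L * |t| := by
      have h2 : (L + 1 / ((n : ℝ) + 1)) / L ≤ (L + 1) / L := by
        gcongr
        rw [div_le_one (by positivity)]
        linarith [n.cast_nonneg (α := ℝ)]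
      have h3 : (L + 1 / ((n : ℝ) + 1)) / L * |t| ≤ (L + 1) / L * |t| := by gcongr
      refine le_trans ?_ h3
      rcases le_total 0 t with ht | ht
      · have := hlip n 0 t ht
        rw [hc0, sub_zero] at this
        rwa [abs_of_nonneg ht]
      · have := hlip n t 0 ht
        rw [hc0, zero_sub, M.dist_comm] at this
        rwa [abs_of_nonpos ht]
    have h2 := (hlow x (c n t)).trans h1
    have h3 : ‖c n t - x‖ ≤ (L + 1) / L * |t| / l := by
      rw [le_div_iff₀ hl]
      linarith
    have h4 := norm_add_le x (c n t - x)
    rw [add_sub_cancel] at h4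
    linarith
  obtain ⟨γ, hγ⟩ := exists_pointwise_limit hbd
  have h0 : γ 0 = x := tendsto_nhds_unique (hγ 0) (by simp [hc0])
  have h1 : γ L = y := tendsto_nhds_unique (hγ L) (by simp [hc1])
  have hγlip : ∀ s t, s ≤ t → M.dist (γ s) (γ t) ≤ t - s := by
    intro s t hst
    have hlim : Tendsto (fun n : ℕ => (L + 1 / ((n : ℝ) + 1)) / L * (t - s)) atTop
        (𝓝 ((L + 0) / L * (t - s))) :=
      ((tendsto_one_div_add_atTop_nhds_zero_nat.const_add L).div_const L).mul_const _
    rw [add_zero, div_self hL.ne', one_mul] at hlim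
    exact le_of_tendsto_of_tendsto (M.tendsto_dist (hγ s) (hγ t))
      (hlim.mono_left Nat.hyperfilter_le_atTop) (Eventually.of_forall fun n => hlip n s t hst)
  refine ⟨γ, h0, h1, fun s t hs hst ht => le_antisymm (hγlip s t hst) ?_⟩
  have h2 := M.dist_triangle (γ 0) (γ s) (γ L)
  have h3 := M.dist_triangle (γ s) (γ t) (γ L)
  have h4 := hγlip 0 s hs
  have h5 := hγlip t L ht
  rw [h0, h1, ← hLdef] at h2
  rw [h0] at h4
  rw [h1] at h3 h5
  linarith

theorem exists_dist_sub_le : ∃ C > 0, ∀ x y, |M.dist x y - M.dist 0 (y - x)| ≤ C := by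
  obtain ⟨u, hu, h⟩ := M.exists_dist_upper
  refine ⟨2 * u, by positivity, fun x y => ?_⟩
  obtain ⟨k, hk⟩ := exists_lat_add_mem_Icc x
  have hn : ‖x + lat k‖ ≤ 1 := by
    have h1 := hk.1
    have h2 := hk.2
    rw [Prod.norm_def, Real.norm_eq_abs, Real.norm_eq_abs]
    exact max_le (abs_le.2 ⟨by linarith [h1.1, show (0 : ℝ × ℝ).1 = 0 from rfl], h2.1⟩)
      (abs_le.2 ⟨by linarith [h1.2, show (0 : ℝ × ℝ).2 = 0 from rfl], h2.2⟩)
  have hu1 : u * ‖x + lat k‖ ≤ u := mul_le_of_le_one_right hu.le hn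
  rw [← M.dist_add_lat k x y]
  have a1 := h 0 (x + lat k)
  have a2 := h (y - x) (y + lat k)
  rw [show y + lat k - (y - x) = x + lat k by abel] at a2
  rw [sub_zero] at a1
  have a3 := M.dist_triangle 0 (x + lat k) (y + lat k)
  have a4 := M.dist_triangle 0 (y + lat k) (y - x)
  have a5 := M.dist_triangle (x + lat k) 0 (y + lat k)
  have a6 := M.dist_triangle 0 (y - x) (y + lat k)
  rw [M.dist_comm (y + lat k) (y - x)] at a4
  rw [M.dist_comm (x + lat k) 0] at a5
  rw [abs_le]
  constructor <;> linarith

theorem exists_stable_limit (h : ℝ × ℝ) :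
    ∃ s, Tendsto (fun t : ℝ => M.dist 0 (t • h) / t) atTop (𝓝 s) := by
  obtain ⟨C, hC, hCb⟩ := M.exists_dist_sub_le
  obtain ⟨u, hu, hup⟩ := M.exists_dist_upper
  have hsub : Subadditive fun n : ℕ => M.dist 0 ((n : ℝ) • h) + C := by
    intro m n
    have h1 := M.dist_triangle 0 ((m : ℝ) • h) (((m + n : ℕ) : ℝ) • h)
    have h2 := (abs_le.1 (hCb ((m : ℝ) • h) (((m + n : ℕ) : ℝ) • h))).2
    rw [show ((m + n : ℕ) : ℝ) • h - (m : ℝ) • h = (n : ℝ) • h by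
      push_cast; rw [add_smul]; abel] at h2
    linarith
  have hlim := hsub.tendsto_lim ⟨0, by
    rintro _ ⟨n, rfl⟩
    have := M.dist_nonneg 0 ((n : ℝ) • h)
    positivity⟩
  refine ⟨hsub.lim, ?_⟩
  have h1 : Tendsto (fun t : ℝ => (M.dist 0 ((⌊t⌋₊ : ℝ) • h) + C) / (⌊t⌋₊ : ℝ) * ((⌊t⌋₊ : ℝ) / t))
      atTop (𝓝 (hsub.lim * 1)) :=
    (hlim.comp tendsto_nat_floor_atTop).mul tendsto_nat_floor_div_atTop
  rw [mul_one] at h1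
  have h2 : Tendsto (fun t : ℝ => (C + u * ‖h‖) / t) atTop (𝓝 0) := tendsto_const_nhds.div_atTop tendsto_id
  have h3 : Tendsto (fun t : ℝ => M.dist 0 (t • h) / t -
      (M.dist 0 ((⌊t⌋₊ : ℝ) • h) + C) / (⌊t⌋₊ : ℝ) * ((⌊t⌋₊ : ℝ) / t)) atTop (𝓝 0) := by
    refine squeeze_zero_norm' ?_ h2
    filter_upwards [eventually_ge_atTop 1] with t ht
    have h4 : (0 : ℝ) < ⌊t⌋₊ := by exact_mod_cast Nat.floor_pos.2 ht
    have h5 : (⌊t⌋₊ : ℝ) ≤ t := Nat.floor_le (by linarith)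
    have h6 : t < ⌊t⌋₊ + 1 := Nat.lt_floor_add_one t
    have ht0 : 0 < t := by linarith
    rw [div_mul_div_cancel₀ h4.ne', ← sub_div, norm_div, Real.norm_of_nonneg ht0.le]
    gcongr
    have h7 := hup (t • h) ((⌊t⌋₊ : ℝ) • h)
    have h8 : ‖(⌊t⌋₊ : ℝ) • h - t • h‖ ≤ ‖h‖ := by
      rw [← sub_smul, norm_smul]
      refine mul_le_of_le_one_left (norm_nonneg _) ?_
      rw [Real.norm_eq_abs, abs_le]
      constructor <;> linarith
    have h9 : u * ‖(⌊t⌋₊ : ℝ) • h - t • h‖ ≤ u * ‖h‖ := by gcongr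
    have h10 := M.dist_triangle 0 (t • h) ((⌊t⌋₊ : ℝ) • h)
    have h11 := M.dist_triangle 0 ((⌊t⌋₊ : ℝ) • h) (t • h)
    rw [M.dist_comm ((⌊t⌋₊ : ℝ) • h) (t • h)] at h11
    rw [Real.norm_eq_abs, abs_le]
    constructor <;> linarith
  simpa using h3.add h1

/-- The stable norm of the metric. -/
def stable (h : ℝ × ℝ) : ℝ := (M.exists_stable_limit h).choose

theorem tendsto_stable (h : ℝ × ℝ) :
    Tendsto (fun t : ℝ => M.dist 0 (t • h) / t) atTop (𝓝 (M.stable h)) :=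
  (M.exists_stable_limit h).choose_spec

theorem stable_smul {a : ℝ} (ha : 0 < a) (h : ℝ × ℝ) : M.stable (a • h) = a * M.stable h := by
  refine tendsto_nhds_unique (M.tendsto_stable (a • h)) ?_
  have h1 := ((M.tendsto_stable h).comp (tendsto_id.const_mul_atTop ha)).const_mul a
  refine h1.congr fun t => ?_
  simp only [Function.comp_apply, id, smul_smul, mul_comm t a]
  by_cases ht : t = 0
  · simp [ht]
  · field_simp

theorem stable_zero : M.stable 0 = 0 :=
  tendsto_nhds_unique (M.tendsto_stable 0) (by simp [dist_self])

theorem exists_stable_lower : ∃ l > 0, ∀ h, l * ‖h‖ ≤ M.stable h := by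
  obtain ⟨l, hl, hlow⟩ := M.exists_dist_lower
  refine ⟨l, hl, fun h => ge_of_tendsto (M.tendsto_stable h) ?_⟩
  filter_upwards [eventually_gt_atTop 0] with t ht
  rw [le_div_iff₀ ht]
  have := hlow 0 (t • h)
  rw [sub_zero, norm_smul, Real.norm_of_nonneg ht.le] at this
  linarith

theorem stable_pos {h : ℝ × ℝ} (hh : h ≠ 0) : 0 < M.stable h := by
  obtain ⟨l, hl, hlow⟩ := M.exists_stable_lower
  exact (mul_pos hl (norm_pos_iff.2 hh)).trans_le (hlow h)

theorem stable_nonneg (h : ℝ × ℝ) : 0 ≤ M.stable h := by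
  obtain ⟨l, hl, hlow⟩ := M.exists_stable_lower
  exact (mul_nonneg hl.le (norm_nonneg h)).trans (hlow h)

theorem stable_add (h h' : ℝ × ℝ) : M.stable (h + h') ≤ M.stable h + M.stable h' := by
  obtain ⟨C, hC, hCb⟩ := M.exists_dist_sub_le
  have h1 : Tendsto (fun t : ℝ => C / t) atTop (𝓝 0) := tendsto_const_nhds.div_atTop tendsto_id
  have h2 := ((M.tendsto_stable h).add (M.tendsto_stable h')).add h1
  rw [add_zero] at h2
  refine le_of_tendsto_of_tendsto (M.tendsto_stable (h + h')) h2 ?_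
  filter_upwards [eventually_gt_atTop 0] with t ht
  rw [← add_div, ← add_div]
  gcongr
  have h3 := M.dist_triangle 0 (t • h) (t • (h + h'))
  have h4 := (abs_le.1 (hCb (t • h) (t • (h + h')))).2
  rw [smul_add, add_sub_cancel_left, ← smul_add] at h4
  linarith

theorem stable_nsmul (n : ℕ) (h : ℝ × ℝ) : M.stable ((n : ℝ) • h) = n * M.stable h := by
  rcases n.eq_zero_or_pos with rfl | hn
  · simp [stable_zero]
  · exact M.stable_smul (by exact_mod_cast hn) h

theorem stable_lat_le (k : ℤ × ℤ) (x : ℝ × ℝ) : M.stable (lat k) ≤ M.dist x (x + lat k) := by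
  obtain ⟨C, hC, hCb⟩ := M.exists_dist_sub_le
  have h1 : ∀ n : ℕ, M.dist x (x + (n : ℝ) • lat k) ≤ n * M.dist x (x + lat k) := by
    intro n
    induction n with
    | zero => simp [dist_self]
    | succ n ih =>
      have h2 := M.dist_triangle x (x + (n : ℝ) • lat k) (x + ((n + 1 : ℕ) : ℝ) • lat k)
      have h3 := M.dist_add_lat (n • k) x (x + lat k)
      rw [lat_nsmul, show x + lat k + (n : ℝ) • lat k = x + ((n + 1 : ℕ) : ℝ) • lat k by
        push_cast; rw [add_smul, one_smul]; abel] at h3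
      rw [h3] at h2
      push_cast at h2 ⊢
      linarith
  have h2 : Tendsto (fun n : ℕ => M.dist 0 ((n : ℝ) • lat k) / (n : ℝ)) atTop
      (𝓝 (M.stable (lat k))) := (M.tendsto_stable (lat k)).comp tendsto_natCast_atTop_atTop
  have h3 : Tendsto (fun n : ℕ => M.dist x (x + lat k) + C / (n : ℝ)) atTop
      (𝓝 (M.dist x (x + lat k) + 0)) :=
    tendsto_const_nhds.add (tendsto_const_nhds.div_atTop tendsto_natCast_atTop_atTop)
  rw [add_zero] at h3
  refine le_of_tendsto_of_tendsto h2 h3 ?_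
  filter_upwards [eventually_gt_atTop 0] with n hn
  have hn' : (0 : ℝ) < n := by exact_mod_cast hn
  rw [div_le_iff₀ hn', add_mul, div_mul_cancel₀ _ hn'.ne']
  have h4 := (abs_le.1 (hCb x (x + (n : ℝ) • lat k))).1
  rw [add_sub_cancel_left] at h4
  linarith [h1 n]

theorem exists_stable_le : ∃ C > 0, ∀ x y, M.stable (y - x) ≤ M.dist x y + C := by
  obtain ⟨C, hC, hCb⟩ := M.exists_dist_sub_le
  have key : ∀ h, M.stable h ≤ M.dist 0 h + C := by
    intro h
    have h1 : ∀ n : ℕ, M.dist 0 ((n : ℝ) • h) ≤ n * (M.dist 0 h + C) := by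
      intro n
      induction n with
      | zero => simp [dist_self]
      | succ n ih =>
        have h2 := M.dist_triangle 0 ((n : ℝ) • h) (((n + 1 : ℕ) : ℝ) • h)
        have h3 := (abs_le.1 (hCb ((n : ℝ) • h) (((n + 1 : ℕ) : ℝ) • h))).2
        rw [show ((n + 1 : ℕ) : ℝ) • h - (n : ℝ) • h = h by push_cast; rw [add_smul]; simp] at h3
        push_cast at h2 h3 ⊢
        linarith
    have h2 : Tendsto (fun n : ℕ => M.dist 0 ((n : ℝ) • h) / (n : ℝ)) atTop
      (𝓝 (M.stable h)) := (M.tendsto_stable h).comp tendsto_natCast_atTop_atTop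
    refine le_of_tendsto h2 ?_
    filter_upwards [eventually_gt_atTop 0] with n hn
    rw [div_le_iff₀ (by exact_mod_cast hn)]
    linarith [h1 n]
  refine ⟨2 * C, by positivity, fun x y => ?_⟩
  linarith [key (y - x), (abs_le.1 (hCb x y)).1]

/-- Supporting linear functionals of the stable norm. -/
theorem exists_calibration {e : ℝ × ℝ} (he : e ≠ 0) :
    ∃ ω : (ℝ × ℝ) →L[ℝ] ℝ, (∀ h, ω h ≤ M.stable h) ∧ ω e = M.stable e := by
  have hle : ∀ x : (LinearPMap.mkSpanSingleton e (M.stable e) he : (ℝ × ℝ) →ₗ.[ℝ] ℝ).domain,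
      (LinearPMap.mkSpanSingleton e (M.stable e) he : (ℝ × ℝ) →ₗ.[ℝ] ℝ) x ≤ M.stable x := by
    rintro ⟨x, hx⟩
    obtain ⟨c, rfl⟩ := Submodule.mem_span_singleton.1 hx
    rw [LinearPMap.mkSpanSingleton'_apply]
    rcases lt_trichotomy c 0 with hc | rfl | hc
    · have h1 := M.stable_nonneg (c • e)
      have h2 := M.stable_nonneg e
      simp only [RingHom.id_apply, smul_eq_mul]
      nlinarith
    · simp [stable_zero]
    · simp [M.stable_smul hc]
  obtain ⟨g, hg1, hg2⟩ := exists_extension_of_le_sublinear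
    (LinearPMap.mkSpanSingleton e (M.stable e) he) M.stable (fun c hc x => M.stable_smul hc x)
    M.stable_add hle
  refine ⟨LinearMap.toContinuousLinearMap g, fun h => hg2 h, ?_⟩
  exact (hg1 ⟨e, Submodule.mem_span_singleton_self e⟩).trans
    (LinearPMap.mkSpanSingleton_apply ℝ ℝ he _)

end TorusMetric

theorem exists_lat_add_norm_le (x : ℝ × ℝ) : ∃ k, ‖x + lat k‖ ≤ 1 := by
  obtain ⟨k, hk⟩ := exists_lat_add_mem_Icc x
  refine ⟨k, ?_⟩
  have h1 := hk.1
  have h2 := hk.2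
  rw [Prod.norm_def, Real.norm_eq_abs, Real.norm_eq_abs]
  exact max_le (abs_le.2 ⟨by linarith [h1.1, show (0 : ℝ × ℝ).1 = 0 from rfl], h2.1⟩)
    (abs_le.2 ⟨by linarith [h1.2, show (0 : ℝ × ℝ).2 = 0 from rfl], h2.2⟩)

namespace TorusMetric

variable (M : TorusMetric)

theorem stable_neg (h : ℝ × ℝ) : M.stable (-h) = M.stable h := by
  obtain ⟨C, hC, hCb⟩ := M.exists_dist_sub_le
  have h1 : Tendsto (fun t : ℝ => C / t) atTop (𝓝 0) := tendsto_const_nhds.div_atTop tendsto_id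
  have h2 : Tendsto (fun t : ℝ => M.dist 0 (t • h) / t - M.dist 0 (t • -h) / t) atTop (𝓝 0) := by
    refine squeeze_zero_norm' ?_ h1
    filter_upwards [eventually_gt_atTop 0] with t ht
    rw [← sub_div, norm_div, Real.norm_of_nonneg ht.le, Real.norm_eq_abs]
    gcongr
    have := hCb (t • h) 0
    rwa [zero_sub, ← smul_neg, M.dist_comm (t • h) 0] at this
  have h3 := tendsto_nhds_unique h2 ((M.tendsto_stable h).sub (M.tendsto_stable (-h)))
  linarith

theorem continuous_stable : Continuous M.stable := by
  obtain ⟨u, hu, h⟩ := M.exists_dist_upper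
  have h1 : ∀ h, M.stable h ≤ u * ‖h‖ := by
    intro h'
    refine le_of_tendsto (M.tendsto_stable h') ?_
    filter_upwards [eventually_gt_atTop 0] with t ht
    rw [div_le_iff₀ ht]
    have := h 0 (t • h')
    rw [sub_zero, norm_smul, Real.norm_of_nonneg ht.le] at this
    linarith
  have h2 : ∀ p q, M.stable p - M.stable q ≤ u * ‖p - q‖ := by
    intro p q
    have h3 := M.stable_add q (p - q)
    rw [add_sub_cancel] at h3
    linarith [h1 (p - q)]
  refine (LipschitzWith.of_dist_le_mul (K := Real.toNNReal u) fun p q => ?_).continuous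
  rw [Real.dist_eq, dist_eq_norm, Real.coe_toNNReal _ hu.le, abs_le]
  refine ⟨?_, h2 p q⟩
  have := h2 q p
  rw [norm_sub_rev] at this
  linarith

theorem exists_far_calibrated {ω : (ℝ × ℝ) →L[ℝ] ℝ} (hω : ∀ h, ω h ≤ M.stable h) {e : ℝ × ℝ}
    (he : e ≠ 0) (hωe : ω e = M.stable e) :
    ∃ C, ∀ N, ∃ y, N ≤ M.dist 0 y ∧ M.dist 0 y - ω y ≤ C := by
  obtain ⟨C₀, hC₀, hst⟩ := M.exists_stable_le
  obtain ⟨u, hu, hup⟩ := M.exists_dist_upper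
  by_contra! hcon
  obtain ⟨N₀, hN₀⟩ := hcon (u + ‖ω‖ + 1)
  obtain ⟨N, hN, hNpos⟩ : ∃ N, N₀ ≤ N ∧ 0 < N :=
    ⟨max N₀ 1, le_max_left _ _, by positivity⟩
  obtain ⟨P, hP⟩ : ∃ P, P = N + u := ⟨_, rfl⟩
  have hPpos : 0 < P := by linarith
  have hpiece : ∀ x y, M.dist x y = P → 1 ≤ P - ω (y - x) := by
    intro x y hxy
    obtain ⟨k, hk⟩ := exists_lat_add_norm_le x
    have h1 := M.dist_add_lat k x y
    have h2 := M.dist_triangle (x + lat k) 0 (y + lat k)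
    have h3 := M.dist_triangle 0 (x + lat k) (y + lat k)
    have h4 := hup 0 (x + lat k)
    rw [M.dist_comm (x + lat k) 0] at h2
    rw [sub_zero] at h4
    have h5 : u * ‖x + lat k‖ ≤ u := mul_le_of_le_one_right hu.le hk
    have h6 := hN₀ (y + lat k) (by linarith)
    have h7 : ω (y + lat k) = ω (y - x) + ω (x + lat k) := by rw [← map_add]; congr 1; abel
    have h8 : -ω (x + lat k) ≤ ‖ω‖ := (neg_le_abs _).trans
      ((ω.le_opNorm _).trans (mul_le_of_le_one_right (norm_nonneg _) hk))
    linarith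
  have hseg : ∀ y, M.dist 0 y / P - 1 - C₀ ≤ M.dist 0 y - ω y := by
    intro y
    obtain ⟨γ, h0, h1, hγ⟩ := M.exists_isSeg 0 y
    have hD := M.dist_nonneg 0 y
    have hind : ∀ n : ℕ, n * P ≤ M.dist 0 y → (n : ℝ) ≤ n * P - ω (γ (n * P)) := by
      intro n
      induction n with
      | zero => simp [h0]
      | succ n ih =>
        intro hn
        push_cast at hn ⊢
        have hn0 : (0 : ℝ) ≤ n * P := by positivity
        have h2 := ih (by linarith)
        have h3 := hγ (n * P) ((n + 1) * P) hn0 (by linarith) hn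
        have h4 := hpiece _ _ (h3.trans (by ring))
        rw [map_sub] at h4
        linarith
    have hn := Nat.floor_le (div_nonneg hD hPpos.le)
    have hn' := Nat.lt_floor_add_one (M.dist 0 y / P)
    obtain ⟨n, hndef⟩ : ∃ n, n = ⌊M.dist 0 y / P⌋₊ := ⟨_, rfl⟩
    rw [← hndef] at hn hn'
    rw [le_div_iff₀ hPpos] at hn
    have h2 := hind n hn
    have h3 := hγ (n * P) _ (by positivity) hn le_rfl
    have h4 := hst (γ (n * P)) y
    have h5 := hω (y - γ (n * P))
    rw [h1] at h3
    rw [map_sub] at h5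
    linarith
  have hlim1 : Tendsto (fun t : ℝ => M.dist 0 (t • e) / t / P - (1 + C₀) / t) atTop
      (𝓝 (M.stable e / P - 0)) := ((M.tendsto_stable e).div_const P).sub
    (tendsto_const_nhds.div_atTop tendsto_id)
  have hlim2 : Tendsto (fun t : ℝ => M.dist 0 (t • e) / t - ω e) atTop
      (𝓝 (M.stable e - ω e)) := (M.tendsto_stable e).sub_const _
  have h1 := le_of_tendsto_of_tendsto hlim1 hlim2 (by
    filter_upwards [eventually_gt_atTop 0] with t ht
    have h2 := hseg (t • e)
    rw [map_smul, smul_eq_mul] at h2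
    have h3 : (M.dist 0 (t • e) / P - 1 - C₀) / t ≤ (M.dist 0 (t • e) - t * ω e) / t := by gcongr
    have h4 : (M.dist 0 (t • e) / P - 1 - C₀) / t =
      M.dist 0 (t • e) / t / P - (1 + C₀) / t := by field_simp; ring
    have h5 : (M.dist 0 (t • e) - t * ω e) / t = M.dist 0 (t • e) / t - ω e := by field_simp
    rwa [h4, h5] at h3)
  rw [hωe, sub_self, sub_zero] at h1
  have := div_pos (M.stable_pos he) hPpos
  linarith

theorem exists_ray {ω : (ℝ × ℝ) →L[ℝ] ℝ} (hω : ∀ h, ω h ≤ M.stable h) {e : ℝ × ℝ}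
    (he : e ≠ 0) (hωe : ω e = M.stable e) (x : ℝ × ℝ) :
    ∃ (γ : ℝ → ℝ × ℝ) (C : ℝ), γ 0 = x ∧ (∀ b, M.IsSeg γ 0 b) ∧
      ∀ t, 0 ≤ t → t - ω (γ t - x) ≤ C := by
  obtain ⟨C, hC⟩ := M.exists_far_calibrated hω he hωe
  obtain ⟨C₀, hC₀, hst⟩ := M.exists_stable_le
  obtain ⟨l, hl, hlow⟩ := M.exists_dist_lower
  choose y hy1 hy2 using fun n : ℕ => hC n
  choose c hc0 hc1 hc using fun n : ℕ => M.exists_isSeg x (y n)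
  have hL : ∀ n, n - M.dist 0 x ≤ M.dist x (y n) := fun n => by
    linarith [hy1 n, M.dist_triangle 0 x (y n)]
  have hev : ∀ t, ∀ᶠ n : ℕ in atTop, t ≤ M.dist x (y n) := fun t => by
    filter_upwards [tendsto_natCast_atTop_atTop.eventually_ge_atTop (t + M.dist 0 x)] with n hn
    linarith [hL n]
  have hbd : ∀ t, ∃ R, ∀ᶠ n in atTop, ‖c n (max t 0)‖ ≤ R := by
    intro t
    refine ⟨‖x‖ + max t 0 / l, (hev (max t 0)).mono fun n hn => ?_⟩
    have h1 := hc n 0 (max t 0) le_rfl (le_max_right _ _) hn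
    have h2 := hlow x (c n (max t 0))
    rw [hc0, sub_zero] at h1
    have h3 : ‖c n (max t 0) - x‖ ≤ max t 0 / l := by
      rw [le_div_iff₀ hl]
      linarith
    have h4 := norm_add_le x (c n (max t 0) - x)
    rw [add_sub_cancel] at h4
    linarith
  obtain ⟨γ, hγ⟩ := exists_pointwise_limit hbd
  have hγ' : ∀ t, 0 ≤ t → Tendsto (fun n => c n t) (hyperfilter ℕ : Filter ℕ) (𝓝 (γ t)) := by
    intro t ht
    have := hγ t
    rwa [max_eq_left ht] at this
  refine ⟨γ, C + M.dist 0 x + ω x + C₀, ?_, ?_, ?_⟩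
  · exact tendsto_nhds_unique (hγ' 0 le_rfl) (by simp only [hc0]; exact tendsto_const_nhds)
  · intro b s t hs hst' _
    have h1 := M.tendsto_dist (hγ' s hs) (hγ' t (hs.trans hst'))
    refine tendsto_nhds_unique h1 (tendsto_const_nhds.congr' ?_)
    filter_upwards [Nat.hyperfilter_le_atTop (hev t)] with n hn
    exact (hc n s t hs hst' hn).symm
  · intro t ht
    have h1 : Tendsto (fun n => t - ω (c n t - x)) (hyperfilter ℕ : Filter ℕ)
        (𝓝 (t - ω (γ t - x))) :=
      tendsto_const_nhds.sub ((ω.continuous.tendsto _).comp ((hγ' t ht).sub_const x))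
    refine le_of_tendsto h1 ?_
    filter_upwards [Nat.hyperfilter_le_atTop (hev t)] with n hn
    have h2 := hc n 0 t le_rfl ht hn
    have h3 := hc n t _ ht hn le_rfl
    rw [hc1] at h3
    have h4 := hst (c n t) (y n)
    have h5 := hω (y n - c n t)
    have h6 := hy2 n
    have h7 := M.dist_triangle x 0 (y n)
    rw [M.dist_comm x 0] at h7
    rw [map_sub] at h5 ⊢
    linarith

/-- Calibrated rays have the direction of the calibrated vector, provided it is unique. -/
theorem tendsto_ray {ω : (ℝ × ℝ) →L[ℝ] ℝ} (hω : ∀ h, ω h ≤ M.stable h) {e : ℝ × ℝ}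
    (he : e ≠ 0) (hωe : ω e = M.stable e) (hface : ∀ h, ω h = M.stable h → ∃ a : ℝ, h = a • e)
    {x : ℝ × ℝ} {γ : ℝ → ℝ × ℝ} {C : ℝ} (h0 : γ 0 = x) (hγ : ∀ b, M.IsSeg γ 0 b)
    (hC : ∀ t, 0 ≤ t → t - ω (γ t - x) ≤ C) :
    Tendsto (fun t : ℝ => t⁻¹ • (γ t - x)) atTop (𝓝 ((M.stable e)⁻¹ • e)) := by
  obtain ⟨C₀, hC₀, hst⟩ := M.exists_stable_le
  obtain ⟨l, hl, hlow⟩ := M.exists_dist_lower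
  have hd : ∀ t, 0 ≤ t → M.dist x (γ t) = t := fun t ht => by
    have := hγ t 0 t le_rfl ht le_rfl
    rwa [h0, sub_zero] at this
  have hσ := M.stable_pos he
  refine (isCompact_closedBall (0 : ℝ × ℝ) l⁻¹).tendsto_nhds_of_unique_mapClusterPt ?_ ?_
  · filter_upwards [eventually_gt_atTop 0] with t ht
    rw [mem_closedBall_zero_iff, norm_smul, norm_inv, Real.norm_of_nonneg ht.le,
      inv_mul_le_iff₀ ht, ← div_eq_mul_inv, le_div_iff₀ hl]
    linarith [hlow x (γ t), hd t ht.le]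
  · intro h _ hh
    obtain ⟨U, hU, hUh⟩ := mapClusterPt_iff_ultrafilter.1 hh
    have hUinv : ∀ A : ℝ, Tendsto (fun t : ℝ => A / t) (U : Filter ℝ) (𝓝 0) := fun A =>
      (tendsto_const_nhds.div_atTop tendsto_id).mono_left hU
    have hω1 : Tendsto (fun t : ℝ => ω (t⁻¹ • (γ t - x))) (U : Filter ℝ) (𝓝 (ω h)) :=
      (ω.continuous.tendsto h).comp hUh
    have hσ1 : Tendsto (fun t : ℝ => M.stable (t⁻¹ • (γ t - x))) (U : Filter ℝ)
        (𝓝 (M.stable h)) := (M.continuous_stable.tendsto h).comp hUh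
    have hpos : ∀ᶠ t : ℝ in (U : Filter ℝ), 0 < t := hU (eventually_gt_atTop 0)
    have a1 : 1 - 0 ≤ ω h := by
      refine le_of_tendsto_of_tendsto ((hUinv C).const_sub 1) hω1 ?_
      filter_upwards [hpos] with t ht
      rw [map_smul, smul_eq_mul, sub_le_iff_le_add, inv_mul_eq_div, ← add_div, le_div_iff₀ ht]
      linarith [hC t ht.le]
    have a2 : M.stable h ≤ 1 + 0 := by
      refine le_of_tendsto_of_tendsto hσ1 ((hUinv C₀).const_add 1) ?_
      filter_upwards [hpos] with t ht
      rw [M.stable_smul (inv_pos.2 ht), inv_mul_eq_div, div_le_iff₀ ht, add_mul,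
        div_mul_cancel₀ _ ht.ne']
      linarith [hst x (γ t), hd t ht.le]
    have a3 := hω h
    obtain ⟨a, rfl⟩ := hface h (by linarith)
    have a4 : a * M.stable e = 1 := by
      rw [← hωe, ← smul_eq_mul, ← map_smul]
      linarith
    rw [eq_inv_of_mul_eq_one_left a4]

end TorusMetric

theorem norm2_smul {a : ℝ} (ha : 0 ≤ a) (p : ℝ × ℝ) : norm2 (a • p) = a * norm2 p := by
  unfold norm2
  rw [Prod.smul_fst, Prod.smul_snd, smul_eq_mul, smul_eq_mul,
    show (a * p.1) ^ 2 + (a * p.2) ^ 2 = a ^ 2 * (p.1 ^ 2 + p.2 ^ 2) by ring,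
    Real.sqrt_mul (sq_nonneg a), Real.sqrt_sq ha]

theorem continuous_norm2 : Continuous norm2 := by
  unfold norm2
  fun_prop

theorem norm2_pos {p : ℝ × ℝ} (hp : p ≠ 0) : 0 < norm2 p := by
  refine Real.sqrt_pos.2 ?_
  by_contra! h
  refine hp (Prod.ext ?_ ?_)
  · exact pow_eq_zero_iff two_ne_zero |>.1 (by nlinarith [sq_nonneg p.1, sq_nonneg p.2])
  · exact pow_eq_zero_iff two_ne_zero |>.1 (by nlinarith [sq_nonneg p.1, sq_nonneg p.2])

/-- A curve with nonzero asymptotic velocity escapes in the direction of that velocity. -/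
theorem escapes_of_tendsto {c : ℝ → ℝ × ℝ} {x h : ℝ × ℝ} (hh : h ≠ 0)
    (hc : Tendsto (fun t : ℝ => t⁻¹ • (c t - x)) atTop (𝓝 h)) :
    EscapesForward c ∧ HasDirection c ((norm2 h)⁻¹ • h) := by
  have h1 : Tendsto (fun t : ℝ => t⁻¹ • x) atTop (𝓝 ((0 : ℝ) • x)) :=
    tendsto_inv_atTop_zero.smul_const x
  have h2 : Tendsto (fun t : ℝ => t⁻¹ • c t) atTop (𝓝 h) := by
    have := hc.add h1
    rw [zero_smul, add_zero] at this
    refine this.congr fun t => ?_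
    rw [← smul_add, sub_add_cancel]
  have h3 : Tendsto (fun t : ℝ => norm2 (t⁻¹ • c t)) atTop (𝓝 (norm2 h)) :=
    (continuous_norm2.tendsto h).comp h2
  have hpos := norm2_pos hh
  refine ⟨?_, ?_, ?_⟩
  · refine (tendsto_id.atTop_mul_pos hpos h3).congr' ?_
    filter_upwards [eventually_gt_atTop 0] with t ht
    rw [norm2_smul (inv_nonneg.2 ht.le), id, mul_inv_cancel_left₀ ht.ne']
  · rw [norm2_smul (inv_nonneg.2 hpos.le), inv_mul_cancel₀ hpos.ne']
  · refine ((h3.inv₀ hpos.ne').smul h2).congr' ?_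
    filter_upwards [eventually_gt_atTop 0] with t ht
    rw [norm2_smul (inv_nonneg.2 ht.le), mul_inv, inv_inv, smul_smul, mul_right_comm,
      mul_inv_cancel₀ ht.ne', one_mul]

theorem projPt_smul {a : ℝ} (ha : a ≠ 0) (h : ℝ × ℝ) : projPt (a • h) = projPt h := by
  unfold projPt
  rw [Prod.smul_fst, Prod.smul_snd, smul_eq_mul, smul_eq_mul, mul_div_mul_left _ _ ha]
  simp [ha]

theorem exists_projPt_eq (r : OnePoint ℝ) : ∃ e : ℝ × ℝ, e ≠ 0 ∧ projPt e = r := by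
  induction r using OnePoint.rec with
  | infty => exact ⟨(0, 1), by simp, by simp [projPt]⟩
  | coe r => exact ⟨(1, r), by simp, by simp [projPt]⟩

theorem exists_continuous_log {f : ℝ × ℝ → ℂ} (hf : Continuous f) (h0 : ∀ p, f p ≠ 0) :
    ∃ G : ℝ × ℝ → ℂ, Continuous G ∧ ∀ p, Complex.exp (G p) = f p := by
  obtain ⟨F, ⟨-, hF⟩, -⟩ := Complex.isCoveringMapOn_exp.existsUnique_continuousMap_lifts
    ⟨f, hf⟩ (a₀ := 0) (e₀ := Complex.log (f 0)) (Complex.exp_log (h0 0)) h0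
  exact ⟨F, F.continuous, fun p => congrFun hF p⟩

theorem eq_of_exp_eq_const {X : Type*} [TopologicalSpace X] [PreconnectedSpace X] {h : X → ℂ}
    (hh : Continuous h) {w : ℂ} (hw : ∀ x, Complex.exp (h x) = w) (x y : X) : h x = h y := by
  have := Complex.isCoveringMap_exp.eq_of_comp_eq hh (continuous_const (y := h y))
    (by ext a; simp [hw]) y rfl
  exact congrFun this x

theorem exists_half_period_eq {γ : ℝ → ℂ} (hγ : Continuous γ) {L : ℝ}
    (hL : ∀ t, γ (t + L) = γ t + 2) : ∃ s t, γ s + 1 = γ t := by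
  by_contra! hcon
  obtain ⟨G, hG, hGf⟩ := exists_continuous_log (f := fun p => γ p.1 + 1 - γ p.2) (by fun_prop)
    fun p => sub_ne_zero.2 (hcon p.1 p.2)
  have hL' : ∀ t, γ t = γ (t - L) + 2 := fun t => by rw [← hL, sub_add_cancel]
  have h1 : ∀ p : ℝ × ℝ, Complex.exp (G (p.2, p.1) - G (p.1 - L, p.2)) = -1 := by
    intro p
    rw [Complex.exp_sub, div_eq_iff (Complex.exp_ne_zero _), hGf, hGf]
    simp only
    rw [hL' p.1]
    ring
  have h2 := eq_of_exp_eq_const (h := fun p : ℝ × ℝ => G (p.2, p.1) - G (p.1 - L, p.2))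
    (by fun_prop) h1
  have h3 := eq_of_exp_eq_const (h := fun t : ℝ => G (t, t)) (w := 1) (by fun_prop)
    (fun t => by rw [hGf]; ring) 0 (-L)
  have h4 := h2 (0, 0) (0, -L)
  have h5 := h1 (0, 0)
  simp only [zero_sub] at h3 h4 h5
  rw [show G (0, 0) - G (-L, 0) = 0 by linear_combination (1 / 2) * h3 + (1 / 2) * h4,
    Complex.exp_zero] at h5
  norm_num at h5

theorem log_I_mul {z : ℂ} (hz : 0 < z.re) :
    Complex.log (Complex.I * z) = Complex.log z + Real.pi / 2 * Complex.I := by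
  have h0 : z ≠ 0 := fun h => by simp [h] at hz
  have harg := abs_lt.1 (Complex.abs_arg_lt_pi_div_two_iff.2 (Or.inl hz))
  rw [(Complex.log_mul_eq_add_log_iff Complex.I_ne_zero h0).2, Complex.log_I, add_comm]
  rw [Complex.arg_I]
  constructor <;> linarith [harg.1, harg.2, Real.pi_pos]

theorem sub_log_eq {h k : ℝ → ℂ} (hh : Continuous h) (hk : ∀ t, Complex.exp (h t) = k t) {w : ℂ}
    (hpos : ∀ t, 0 < (w * k t).re) (t t' : ℝ) :
    h t - Complex.log (w * k t) = h t' - Complex.log (w * k t') := by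
  have hkc : Continuous k := by
    rw [← funext hk]
    fun_prop
  refine eq_of_exp_eq_const (h := fun t => h t - Complex.log (w * k t)) (w := w⁻¹) ?_ ?_ t t'
  · refine hh.sub (Continuous.clog (by fun_prop) fun x => ?_)
    exact Or.inl (hpos x)
  · intro x
    have h0 : w * k x ≠ 0 := fun h => by simpa [h] using hpos x
    rw [Complex.exp_sub, hk, Complex.exp_log h0, mul_comm w,
      div_mul_cancel_left₀ (right_ne_zero_of_mul h0)]

theorem exists_eq_of_transverse_periods {γ₁ γ₂ : ℝ → ℂ} (h₁ : Continuous γ₁) (h₂ : Continuous γ₂)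
    {L₁ L₂ : ℝ} (hL₁ : 0 < L₁) (hL₂ : 0 < L₂) (hp₁ : ∀ t, γ₁ (t + L₁) = γ₁ t + 1)
    (hp₂ : ∀ t, γ₂ (t + L₂) = γ₂ t + Complex.I) : ∃ s t, γ₁ s = γ₂ t := by
  by_contra! hcon
  obtain ⟨G, hG, hGf⟩ := exists_continuous_log (f := fun p => γ₁ p.1 - γ₂ p.2) (by fun_prop)
    fun p => sub_ne_zero.2 (hcon p.1 p.2)
  have hbd : ∀ (u : ℝ → ℝ) (L : ℝ), 0 < L → Continuous u → (∀ t, u (t + L) = u t) →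
      ∃ B, ∀ t, |u t| ≤ B := by
    intro u L hL hu hper
    obtain ⟨B, hB⟩ := (Function.Periodic.isBounded_of_continuous (f := u) hper hL.ne' hu).exists_norm_le
    exact ⟨B, fun t => hB _ (mem_range_self t)⟩
  obtain ⟨B₁, hB₁⟩ := hbd (fun t => (γ₁ t).im) L₁ hL₁ (by fun_prop) fun t => by simp [hp₁]
  obtain ⟨B₂, hB₂⟩ := hbd (fun t => (γ₂ t).re) L₂ hL₂ (by fun_prop) fun t => by simp [hp₂]
  have hup₁ : ∀ n : ℕ, (γ₁ (n * L₁)).re = (γ₁ 0).re + n ∧ (γ₁ (-(n * L₁))).re = (γ₁ 0).re - n := by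
    intro n
    induction n with
    | zero => simp
    | succ n ih =>
      have a1 := congrArg Complex.re (hp₁ (n * L₁))
      have a2 := congrArg Complex.re (hp₁ (-((n + 1 : ℕ) * L₁)))
      rw [show (n : ℝ) * L₁ + L₁ = (n + 1 : ℕ) * L₁ by push_cast; ring] at a1
      rw [show -((n + 1 : ℕ) * L₁) + L₁ = -(n * L₁) by push_cast; ring] at a2
      simp only [Complex.add_re, Complex.one_re] at a1 a2
      push_cast at a1 a2 ⊢
      constructor <;> linarith [ih.1, ih.2]
  have hup₂ : ∀ n : ℕ, (γ₂ (n * L₂)).im = (γ₂ 0).im + n ∧ (γ₂ (-(n * L₂))).im = (γ₂ 0).im - n := by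
    intro n
    induction n with
    | zero => simp
    | succ n ih =>
      have a1 := congrArg Complex.im (hp₂ (n * L₂))
      have a2 := congrArg Complex.im (hp₂ (-((n + 1 : ℕ) * L₂)))
      rw [show (n : ℝ) * L₂ + L₂ = (n + 1 : ℕ) * L₂ by push_cast; ring] at a1
      rw [show -((n + 1 : ℕ) * L₂) + L₂ = -(n * L₂) by push_cast; ring] at a2
      simp only [Complex.add_im, Complex.I_im] at a1 a2
      push_cast at a1 a2 ⊢
      constructor <;> linarith [ih.1, ih.2]
  obtain ⟨n, hn⟩ := exists_nat_gt (B₂ + |(γ₁ 0).re|)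
  obtain ⟨m, hm⟩ := exists_nat_gt (B₁ + |(γ₂ 0).im|)
  obtain ⟨S, hS⟩ : ∃ S, S = n * L₁ := ⟨_, rfl⟩
  obtain ⟨T, hT⟩ : ∃ T, T = m * L₂ := ⟨_, rfl⟩
  obtain ⟨hu1, hu1'⟩ := hup₁ n
  obtain ⟨hu2, hu2'⟩ := hup₂ m
  rw [← hS] at hu1 hu1'
  rw [← hT] at hu2 hu2'
  have e1 := abs_le.1 (le_refl |(γ₁ 0).re|)
  have e2 := abs_le.1 (le_refl |(γ₂ 0).im|)
  have r0 : ∀ t, 0 < (1 * (γ₁ S - γ₂ t)).re := fun t => by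
    rw [one_mul, Complex.sub_re]; linarith [abs_le.1 (hB₂ t)]
  have r1 : ∀ s, 0 < (Complex.I * (γ₁ s - γ₂ T)).re := fun s => by
    rw [Complex.I_mul_re, Complex.sub_im]; linarith [abs_le.1 (hB₁ s)]
  have r2 : ∀ t, 0 < (-1 * (γ₁ (-S) - γ₂ t)).re := fun t => by
    rw [neg_one_mul, Complex.neg_re, Complex.sub_re]; linarith [abs_le.1 (hB₂ t)]
  have r3 : ∀ s, 0 < (-Complex.I * (γ₁ s - γ₂ (-T))).re := fun s => by
    rw [neg_mul, Complex.neg_re, Complex.I_mul_re, Complex.sub_im]; linarith [abs_le.1 (hB₁ s)]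
  have s0 := sub_log_eq (h := fun t => G (S, t)) (by fun_prop) (fun t => hGf (S, t)) r0 (-T) T
  have s1 := sub_log_eq (h := fun s => G (s, T)) (by fun_prop) (fun s => hGf (s, T)) r1 S (-S)
  have s2 := sub_log_eq (h := fun t => G (-S, t)) (by fun_prop) (fun t => hGf (-S, t)) r2 T (-T)
  have s3 := sub_log_eq (h := fun s => G (s, -T)) (by fun_prop) (fun s => hGf (s, -T)) r3 (-S) S
  have c0 := log_I_mul (r0 T)
  have c1 := log_I_mul (r1 (-S))
  have c2 := log_I_mul (r2 (-T))
  have c3 := log_I_mul (r3 S)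
  rw [← mul_assoc, mul_one] at c0
  rw [← mul_assoc, Complex.I_mul_I] at c1
  rw [← mul_assoc, mul_neg_one] at c2
  rw [← mul_assoc, mul_neg, Complex.I_mul_I, neg_neg] at c3
  have h6 : (2 * Real.pi * Complex.I : ℂ) = 0 := by
    linear_combination -s0 - s1 - s2 - s3 - c0 - c1 - c2 - c3
  exact Complex.two_pi_I_ne_zero h6

/-- A curve invariant under translation by `2 v` meets its translate by `v`. -/
theorem exists_add_eq_of_periodic {Γ : ℝ → ℝ × ℝ} (hΓ : Continuous Γ) {L : ℝ} {v : ℝ × ℝ}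
    (hv : v ≠ 0) (hL : ∀ t, Γ (t + L) = Γ t + (2 : ℝ) • v) : ∃ s t, Γ s + v = Γ t := by
  obtain ⟨Φ, hΦ⟩ : ∃ Φ : ℝ × ℝ → ℂ, Φ = fun p => p.1 + p.2 * Complex.I := ⟨_, rfl⟩
  have hinj : Function.Injective Φ := by
    intro p q hpq
    rw [hΦ] at hpq
    exact Prod.ext (by simpa using congrArg Complex.re hpq) (by simpa using congrArg Complex.im hpq)
  have h0 : Φ 0 = 0 := by simp [hΦ]
  have hadd : ∀ p q, Φ (p + q) = Φ p + Φ q := by intro p q; simp [hΦ]; ring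
  have hsmul : Φ ((2 : ℝ) • v) = 2 * Φ v := by simp [hΦ]; ring
  have hv' : Φ v ≠ 0 := fun h => hv (hinj (h.trans h0.symm))
  obtain ⟨s, t, h⟩ := exists_half_period_eq (γ := fun t => Φ (Γ t) / Φ v) (L := L)
    (by rw [hΦ]; fun_prop) (fun t => by rw [hL, hadd, hsmul]; field_simp)
  refine ⟨s, t, hinj ?_⟩
  rw [hadd]
  field_simp at h
  exact h

theorem exists_eq_of_crossDet_ne_zero {Γ₁ Γ₂ : ℝ → ℝ × ℝ} (h₁ : Continuous Γ₁) (h₂ : Continuous Γ₂)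
    {L₁ L₂ : ℝ} (hL₁ : 0 < L₁) (hL₂ : 0 < L₂) {v₁ v₂ : ℝ × ℝ} (hv : crossDet v₁ v₂ ≠ 0)
    (hp₁ : ∀ t, Γ₁ (t + L₁) = Γ₁ t + v₁) (hp₂ : ∀ t, Γ₂ (t + L₂) = Γ₂ t + v₂) :
    ∃ s t, Γ₁ s = Γ₂ t := by
  obtain ⟨D, hD⟩ : ∃ D, D = crossDet v₁ v₂ := ⟨_, rfl⟩
  rw [← hD] at hv
  unfold crossDet at hD
  obtain ⟨Φ, hΦ⟩ : ∃ Φ : ℝ × ℝ → ℂ, Φ = fun p => (((p.1 * v₂.2 - p.2 * v₂.1) / D : ℝ) : ℂ) +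
      ((v₁.1 * p.2 - v₁.2 * p.1) / D : ℝ) * Complex.I := ⟨_, rfl⟩
  have hinj : Function.Injective Φ := by
    intro p q hpq
    rw [hΦ] at hpq
    have a1 := congrArg Complex.re hpq
    have a2 := congrArg Complex.im hpq
    simp only [Complex.add_re, Complex.ofReal_re, Complex.mul_re, Complex.I_re, mul_zero,
      Complex.ofReal_im, Complex.I_im, mul_one, sub_self, add_zero, Complex.add_im,
      Complex.mul_im, zero_add] at a1 a2
    rw [div_left_inj' hv] at a1 a2
    refine Prod.ext (mul_left_cancel₀ hv ?_) (mul_left_cancel₀ hv ?_)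
    · rw [hD]; linear_combination v₁.1 * a1 + v₂.1 * a2
    · rw [hD]; linear_combination v₁.2 * a1 + v₂.2 * a2
  have hadd : ∀ p q, Φ (p + q) = Φ p + Φ q := by
    intro p q
    rw [hΦ]
    simp only [Prod.fst_add, Prod.snd_add]
    push_cast
    ring
  have hv1 : Φ v₁ = 1 := by
    rw [hΦ]
    simp only
    rw [← hD, div_self hv, mul_comm v₁.2, sub_self]
    simp
  have hv2 : Φ v₂ = Complex.I := by
    rw [hΦ]
    simp only
    rw [← hD, div_self hv, mul_comm v₂.2, sub_self]
    simp
  obtain ⟨s, t, h⟩ := exists_eq_of_transverse_periods (γ₁ := fun t => Φ (Γ₁ t))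
    (γ₂ := fun t => Φ (Γ₂ t)) (by rw [hΦ]; fun_prop) (by rw [hΦ]; fun_prop) hL₁ hL₂
    (fun t => by rw [hp₁, hadd, hv1]) (fun t => by rw [hp₂, hadd, hv2])
  exact ⟨s, t, hinj h⟩

theorem apply_add_zsmul_of_periodic {Γ : ℝ → ℝ × ℝ} {L : ℝ} {w : ℝ × ℝ}
    (hΓ : ∀ t, Γ (t + L) = Γ t + w) (t : ℝ) (m : ℤ) : Γ (t + m * L) = Γ t + (m : ℝ) • w := by
  induction m using Int.induction_on with
  | zero => simp
  | succ m ih =>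
    push_cast at ih ⊢
    rw [add_mul, one_mul, ← add_assoc, hΓ, ih, add_smul, one_smul, add_assoc]
  | pred m ih =>
    have := hΓ (t + ((-m - 1 : ℤ) : ℝ) * L)
    push_cast at ih this ⊢
    rw [show t + (-(m : ℝ) - 1) * L + L = t + -(m : ℝ) * L by ring, ih] at this
    rw [← sub_eq_iff_eq_add.2 this, sub_smul, one_smul]
    abel

namespace TorusMetric

variable (M : TorusMetric)

theorem exists_minDisp (k : ℤ × ℤ) : ∃ x, ∀ y, M.dist x (x + lat k) ≤ M.dist y (y + lat k) := by
  have hcont : Continuous fun x => M.dist x (x + lat k) :=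
    M.continuous_dist.comp (f := fun x : ℝ × ℝ => (x, x + lat k)) (by fun_prop)
  obtain ⟨x, -, hx⟩ := (isCompact_closedBall (0 : ℝ × ℝ) 1).exists_isMinOn
    ⟨0, by simp⟩ hcont.continuousOn
  refine ⟨x, fun y => ?_⟩
  obtain ⟨j, hj⟩ := exists_lat_add_norm_le y
  have h1 := hx (mem_closedBall_zero_iff.2 hj)
  have h2 := M.dist_add_lat j y (y + lat k)
  rw [add_right_comm] at h2
  exact h1.trans h2.le

/-- The minimal displacement of a covering translation. -/
def minDisp (k : ℤ × ℤ) : ℝ := M.dist (M.exists_minDisp k).choose ((M.exists_minDisp k).choose + lat k)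

theorem exists_dist_eq_minDisp (k : ℤ × ℤ) : ∃ x, M.dist x (x + lat k) = M.minDisp k := ⟨_, rfl⟩

theorem minDisp_le (k : ℤ × ℤ) (y : ℝ × ℝ) : M.minDisp k ≤ M.dist y (y + lat k) :=
  (M.exists_minDisp k).choose_spec y

theorem stable_lat_le_minDisp (k : ℤ × ℤ) : M.stable (lat k) ≤ M.minDisp k :=
  M.stable_lat_le k _

theorem stable_lat_zsmul (m : ℤ) (k : ℤ × ℤ) :
    M.stable (lat (m • k)) = |(m : ℝ)| * M.stable (lat k) := by
  rw [lat_zsmul]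
  rcases lt_trichotomy (m : ℝ) 0 with h | h | h
  · rw [abs_of_neg h, ← M.stable_smul (neg_pos.2 h), neg_smul, stable_neg]
  · rw [h, zero_smul, stable_zero, abs_zero, zero_mul]
  · rw [abs_of_pos h, M.stable_smul h]

theorem continuous_of_dist_le {Γ : ℝ → ℝ × ℝ} (h : ∀ s t, s ≤ t → M.dist (Γ s) (Γ t) ≤ t - s) :
    Continuous Γ := by
  obtain ⟨l, hl, hlow⟩ := M.exists_dist_lower
  have key : ∀ s t, s ≤ t → ‖Γ t - Γ s‖ ≤ l⁻¹ * |t - s| := by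
    intro s t hst
    rw [le_inv_mul_iff₀ hl, abs_of_nonneg (sub_nonneg.2 hst)]
    exact (hlow _ _).trans (h s t hst)
  refine (LipschitzWith.of_dist_le_mul (K := Real.toNNReal l⁻¹) fun s t => ?_).continuous
  rw [Real.dist_eq, dist_eq_norm, Real.coe_toNNReal _ (by positivity)]
  rcases le_total s t with hst | hst
  · rw [norm_sub_rev, abs_sub_comm]
    exact key s t hst
  · exact key t s hst

/-- A minimal segment from a point to its image under a translation extends to an invariant
curve. -/
theorem exists_periodic_curve {k : ℤ × ℤ} {x : ℝ × ℝ} {L : ℝ} (hL : 0 < L)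
    (hx : M.dist x (x + lat k) = L) :
    ∃ Γ : ℝ → ℝ × ℝ, (∀ t, Γ (t + L) = Γ t + lat k) ∧
      ∀ s t, s ≤ t → M.dist (Γ s) (Γ t) ≤ t - s := by
  obtain ⟨γ, h0, h1, hγ⟩ := M.exists_isSeg x (x + lat k)
  rw [hx] at h1 hγ
  obtain ⟨Γ, hΓ⟩ : ∃ Γ : ℝ → ℝ × ℝ,
    Γ = fun t => γ (t - ⌊t / L⌋ * L) + (⌊t / L⌋ : ℝ) • lat k := ⟨_, rfl⟩
  have hcell : ∀ (m : ℤ) (t : ℝ), m * L ≤ t → t ≤ (m + 1) * L →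
      Γ t = γ (t - m * L) + lat (m • k) := by
    intro m t ht ht'
    rw [lat_zsmul, hΓ]
    rcases ht'.eq_or_lt with rfl | hlt
    · have : ⌊(((m : ℝ) + 1) * L) / L⌋ = m + 1 := by
        rw [mul_div_cancel_right₀ _ hL.ne']
        exact_mod_cast Int.floor_intCast (m + 1)
      simp only [this]
      push_cast
      rw [sub_self, h0, show ((m : ℝ) + 1) * L - m * L = L by ring, h1, add_smul, one_smul]
      abel
    · have : ⌊t / L⌋ = m := by
        rw [Int.floor_eq_iff, le_div_iff₀ hL, div_lt_iff₀ hL]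
        exact ⟨ht, hlt⟩
      simp only [this]
  have hdist : ∀ (m : ℤ) (s t : ℝ), m * L ≤ s → s ≤ t → t ≤ (m + 1) * L →
      M.dist (Γ s) (Γ t) = t - s := by
    intro m s t hs hst ht
    rw [hcell m s hs (hst.trans ht), hcell m t (hs.trans hst) ht, dist_add_lat,
      hγ _ _ (by linarith) (by linarith) (by linarith)]
    ring
  refine ⟨Γ, fun t => ?_, fun s t hst => ?_⟩
  · rw [hΓ]
    have : ⌊(t + L) / L⌋ = ⌊t / L⌋ + 1 := by
      rw [add_div, div_self hL.ne', Int.floor_add_one]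
    simp only [this]
    push_cast
    rw [show t + L - ((⌊t / L⌋ : ℝ) + 1) * L = t - ⌊t / L⌋ * L by ring, add_smul, one_smul,
      add_assoc]
  · have hs1 : (⌊s / L⌋ : ℝ) * L ≤ s := (le_div_iff₀ hL).1 (Int.floor_le _)
    have hs2 : s ≤ (⌊s / L⌋ + 1) * L := ((div_lt_iff₀ hL).1 (Int.lt_floor_add_one _)).le
    have hind : ∀ (n : ℕ) (t : ℝ), s ≤ t → t ≤ (⌊s / L⌋ + n + 1) * L →
        M.dist (Γ s) (Γ t) ≤ t - s := by
      intro n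
      induction n with
      | zero =>
        intro t hst ht
        refine (hdist ⌊s / L⌋ s t hs1 hst ?_).le
        simpa using ht
      | succ n ih =>
        intro t hst ht
        rcases le_total t ((⌊s / L⌋ + n + 1) * L) with h | h
        · exact ih t hst h
        · have a0 : s ≤ (⌊s / L⌋ + n + 1) * L := hs2.trans (by gcongr; linarith)
          have a1 := ih _ a0 le_rfl
          have a2 := hdist (⌊s / L⌋ + n + 1) ((⌊s / L⌋ + n + 1) * L) t (by push_cast; rfl) h
            (by push_cast at ht ⊢; linarith)
          have a3 := M.dist_triangle (Γ s) (Γ ((⌊s / L⌋ + n + 1) * L)) (Γ t)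
          linarith
    obtain ⟨n, hn⟩ := exists_nat_ge ((t - s) / L)
    refine hind n t hst ?_
    rw [div_le_iff₀ hL] at hn
    nlinarith

theorem two_mul_minDisp_le {k : ℤ × ℤ} (hk : k ≠ 0)
    (h : M.minDisp ((2 : ℤ) • k) < 4 * M.stable (lat k)) :
    2 * M.minDisp k ≤ M.minDisp ((2 : ℤ) • k) := by
  obtain ⟨x, hx⟩ := M.exists_dist_eq_minDisp ((2 : ℤ) • k)
  obtain ⟨L, hLdef⟩ : ∃ L, L = M.minDisp ((2 : ℤ) • k) := ⟨_, rfl⟩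
  have hσ := M.stable_pos (lat_ne_zero hk)
  have hL : 0 < L := by
    have := M.stable_lat_le_minDisp ((2 : ℤ) • k)
    rw [stable_lat_zsmul, ← hLdef] at this
    norm_num at this
    linarith
  rw [← hLdef] at h hx ⊢
  obtain ⟨Γ, hper, hlip⟩ := M.exists_periodic_curve hL hx
  obtain ⟨s, t, hst⟩ := exists_add_eq_of_periodic (M.continuous_of_dist_le hlip) (lat_ne_zero hk)
    (L := L) (fun t => by rw [hper, lat_zsmul, Int.cast_ofNat])
  obtain ⟨j, hj⟩ : ∃ j, j = ⌊(t - s) / L⌋ := ⟨_, rfl⟩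
  have hj1 : (j : ℝ) * L ≤ t - s := hj ▸ (le_div_iff₀ hL).1 (Int.floor_le _)
  have hj2 : t - s < (j + 1) * L := hj ▸ (div_lt_iff₀ hL).1 (Int.lt_floor_add_one _)
  have e1 : Γ (t - j * L) = Γ s + lat ((1 - 2 * j) • k) := by
    have := apply_add_zsmul_of_periodic hper t (-j)
    rw [← hst, lat_zsmul] at this
    rw [lat_zsmul, sub_eq_add_neg, ← neg_mul]
    push_cast at this ⊢
    rw [this]
    module
  have e2 : Γ (s + L) = Γ (t - j * L) + lat ((1 + 2 * j) • k) := by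
    rw [hper, e1, lat_zsmul, lat_zsmul, lat_zsmul]
    push_cast
    module
  have d1 := hlip s (t - j * L) (by linarith)
  have d2 := hlip (t - j * L) (s + L) (by linarith)
  rw [e1] at d1
  rw [e2] at d2
  by_cases hj0 : j = 0
  · subst hj0
    have b1 := M.minDisp_le ((1 - 2 * 0 : ℤ) • k) (Γ s)
    have b2 := M.minDisp_le ((1 + 2 * 0 : ℤ) • k) (Γ (t - (0 : ℤ) * L))
    simp only [mul_zero, sub_zero, add_zero, one_smul] at b1 b2 d1 d2
    linarith
  · have b1 := M.stable_lat_le ((1 - 2 * j : ℤ) • k) (Γ s)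
    have b2 := M.stable_lat_le ((1 + 2 * j : ℤ) • k) (Γ (t - j * L))
    rw [stable_lat_zsmul] at b1 b2
    have b3 : (4 : ℝ) ≤ |((1 - 2 * j : ℤ) : ℝ)| + |((1 + 2 * j : ℤ) : ℝ)| := by
      have : (4 : ℤ) ≤ |1 - 2 * j| + |1 + 2 * j| := by
        rcases abs_cases (1 - 2 * j) with h | h <;> rcases abs_cases (1 + 2 * j) with h' | h' <;>
          omega
      exact_mod_cast this
    nlinarith

theorem exists_dist_eq_stable {k : ℤ × ℤ} (hk : k ≠ 0) :
    ∃ n : ℕ, 0 < n ∧ ∃ x, M.dist x (x + lat (n • k)) = M.stable (lat (n • k)) := by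
  have hσ := M.stable_pos (lat_ne_zero hk)
  have hup : ∀ n : ℕ, M.minDisp (n • k) ≤ M.dist 0 ((n : ℝ) • lat k) := by
    intro n
    have := M.minDisp_le (n • k) 0
    rwa [zero_add, lat_nsmul] at this
  obtain ⟨T, hT⟩ := eventually_atTop.1 ((M.tendsto_stable (lat k)).eventually_lt_const
    (show M.stable (lat k) < 2 * M.stable (lat k) by linarith))
  obtain ⟨n₀, hn₀⟩ := exists_nat_gt (max T 0)
  have hn₀pos : (0 : ℝ) < n₀ := (le_max_right _ _).trans_lt hn₀
  have hn₀pos' : 0 < n₀ := by exact_mod_cast hn₀pos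
  have hstep : ∀ n : ℕ, n₀ ≤ n → 2 * M.minDisp (n • k) ≤ M.minDisp ((2 * n) • k) := by
    intro n hn
    have hn' : (n₀ : ℝ) ≤ n := by exact_mod_cast hn
    have h1 := hT ((2 * n : ℕ) : ℝ) (by push_cast; linarith [le_max_left T 0])
    rw [div_lt_iff₀ (by push_cast; linarith)] at h1
    have h2 := hup (2 * n)
    have h3 : (2 * n) • k = (2 : ℤ) • (n • k) := by
      rw [mul_smul]
      exact_mod_cast rfl
    rw [h3] at h2 ⊢
    refine M.two_mul_minDisp_le (smul_ne_zero (by omega) hk) ?_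
    rw [lat_nsmul, stable_nsmul]
    push_cast at h1 h2
    linarith
  have hiter : ∀ i : ℕ, 2 ^ i * M.minDisp (n₀ • k) ≤ M.minDisp ((2 ^ i * n₀) • k) := by
    intro i
    induction i with
    | zero => simp
    | succ i ih =>
      have := hstep (2 ^ i * n₀) (Nat.le_mul_of_pos_left _ (by positivity))
      rw [← mul_assoc, ← pow_succ'] at this
      rw [pow_succ']
      linarith
  refine ⟨n₀, hn₀pos', ?_⟩
  obtain ⟨x, hx⟩ := M.exists_dist_eq_minDisp (n₀ • k)
  refine ⟨x, le_antisymm ?_ (M.stable_lat_le _ _)⟩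
  rw [hx, lat_nsmul, stable_nsmul, ← div_le_iff₀' hn₀pos]
  have htop : Tendsto (fun i : ℕ => (2 ^ i * n₀ : ℝ)) atTop atTop :=
    (tendsto_pow_atTop_atTop_of_one_lt one_lt_two).atTop_mul_const hn₀pos
  refine ge_of_tendsto' ((M.tendsto_stable (lat k)).comp htop) fun i => ?_
  have h1 := (hiter i).trans (hup _)
  have h2 : (0 : ℝ) < 2 ^ i := by positivity
  push_cast at h1
  simp only [Function.comp_apply]
  rw [div_le_div_iff₀ hn₀pos (by positivity)]
  nlinarith

/-- An invariant curve of minimal period is globally minimizing. -/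
theorem isSeg_of_periodic {k : ℤ × ℤ} {L : ℝ} (hL : 0 < L) (hk : L = M.stable (lat k))
    {Γ : ℝ → ℝ × ℝ} (hper : ∀ t, Γ (t + L) = Γ t + lat k)
    (hlip : ∀ s t, s ≤ t → M.dist (Γ s) (Γ t) ≤ t - s) (a b : ℝ) : M.IsSeg Γ a b := by
  intro s t _ hst _
  refine le_antisymm (hlip s t hst) ?_
  obtain ⟨n, hn⟩ := exists_nat_ge ((t - s) / L)
  rw [div_le_iff₀ hL] at hn
  have h1 := M.stable_lat_le ((n : ℤ) • k) (Γ s)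
  have h2 := apply_add_zsmul_of_periodic hper s n
  rw [← lat_zsmul] at h2
  rw [← h2, stable_lat_zsmul, ← hk] at h1
  push_cast at h1
  rw [Nat.abs_cast] at h1
  have h3 := hlip t (s + n * L) (by linarith)
  have h4 := M.dist_triangle (Γ s) (Γ t) (Γ (s + n * L))
  linarith

end TorusMetric

theorem eq_smul_of_crossDet_eq_zero {e h : ℝ × ℝ} (he : e ≠ 0) (hd : crossDet e h = 0) :
    ∃ a : ℝ, h = a • e := by
  unfold crossDet at hd
  by_cases h1 : e.1 = 0
  · have h2 : e.2 ≠ 0 := fun h2 => he (Prod.ext h1 h2)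
    refine ⟨h.2 / e.2, Prod.ext ?_ ?_⟩
    · rw [h1] at hd
      have : h.1 = 0 := by
        rw [zero_mul, zero_sub, neg_eq_zero] at hd
        exact (mul_eq_zero.1 hd).resolve_left h2
      simp [h1, this]
    · simp [h2]
  · refine ⟨h.1 / e.1, Prod.ext ?_ ?_⟩
    · simp [h1]
    · simp only [Prod.smul_snd, smul_eq_mul]
      field_simp
      linarith

/-- Every open cone contains two independent lattice vectors. -/
theorem exists_lat_mem_cone {e h : ℝ × ℝ} (hd : crossDet e h ≠ 0) :
    ∃ k₁ k₂ : ℤ × ℤ, crossDet (lat k₁) (lat k₂) ≠ 0 ∧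
      (∃ a b : ℝ, 0 < a ∧ 0 < b ∧ lat k₁ = a • e + b • h) ∧
      ∃ a b : ℝ, 0 < a ∧ 0 < b ∧ lat k₂ = a • e + b • h := by
  obtain ⟨D, hD⟩ : ∃ D, D = crossDet e h := ⟨_, rfl⟩
  rw [← hD] at hd
  unfold crossDet at hD
  obtain ⟨B, hB⟩ : ∃ B, B = (2 * (|h.1| + |h.2| + |e.1| + |e.2|)) / |D| := ⟨_, rfl⟩
  have hDpos : 0 < |D| := abs_pos.2 hd
  have hB0 : 0 ≤ B := by rw [hB]; positivity
  have hsmall : ∀ p : ℝ × ℝ, |p.1| ≤ 2 → |p.2| ≤ 2 →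
      |(p.1 * h.2 - p.2 * h.1) / D| ≤ B ∧ |(e.1 * p.2 - e.2 * p.1) / D| ≤ B := by
    intro p h1 h2
    have aux : ∀ x y : ℝ, |p.1 * x - p.2 * y| ≤ 2 * (|x| + |y|) := by
      intro x y
      calc |p.1 * x - p.2 * y| ≤ |p.1 * x| + |p.2 * y| := abs_sub _ _
        _ = |p.1| * |x| + |p.2| * |y| := by rw [abs_mul, abs_mul]
        _ ≤ 2 * |x| + 2 * |y| := by gcongr
        _ = 2 * (|x| + |y|) := by ring
    rw [hB, abs_div, abs_div]
    constructor
    · gcongr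
      linarith [aux h.2 h.1, abs_nonneg e.1, abs_nonneg e.2]
    · gcongr
      have := aux e.2 e.1
      rw [abs_sub_comm, mul_comm p.2, mul_comm p.1] at this
      linarith [abs_nonneg h.1, abs_nonneg h.2]
  obtain ⟨q, hq⟩ : ∃ q, q = (B + 1) • (e + h) := ⟨_, rfl⟩
  have hq1 : q.1 = (B + 1) * (e.1 + h.1) := by simp [hq, mul_add]
  have hq2 : q.2 = (B + 1) * (e.2 + h.2) := by simp [hq, mul_add]
  have hcone : ∀ k : ℤ × ℤ, |(lat k - q).1| ≤ 2 → |(lat k - q).2| ≤ 2 →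
      ∃ a b : ℝ, 0 < a ∧ 0 < b ∧ lat k = a • e + b • h := by
    intro k h1 h2
    obtain ⟨b1, b2⟩ := hsmall _ h1 h2
    obtain ⟨p, hp⟩ : ∃ p, p = lat k - q := ⟨_, rfl⟩
    rw [← hp] at b1 b2
    refine ⟨B + 1 + (p.1 * h.2 - p.2 * h.1) / D, B + 1 + (e.1 * p.2 - e.2 * p.1) / D,
      by linarith [(abs_le.1 b1).1], by linarith [(abs_le.1 b2).1], ?_⟩
    rw [sub_eq_iff_eq_add.1 hp.symm]
    refine Prod.ext ?_ ?_
    · simp only [Prod.fst_add, Prod.smul_fst, smul_eq_mul]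
      rw [hq1]
      field_simp
      rw [hD]
      ring
    · simp only [Prod.snd_add, Prod.smul_snd, smul_eq_mul]
      rw [hq2]
      field_simp
      rw [hD]
      ring
  have hf1 := Int.floor_le q.1
  have hf1' := Int.lt_floor_add_one q.1
  have hf2 := Int.floor_le q.2
  have hf2' := Int.lt_floor_add_one q.2
  have hcone' : ∀ i j : ℤ, 0 ≤ i → i ≤ 1 → 0 ≤ j → j ≤ 1 →
      ∃ a b : ℝ, 0 < a ∧ 0 < b ∧ lat (⌊q.1⌋ + i, ⌊q.2⌋ + j) = a • e + b • h := by
    intro i j hi hi' hj hj'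
    have c1 : (0 : ℝ) ≤ i := by exact_mod_cast hi
    have c2 : (i : ℝ) ≤ 1 := by exact_mod_cast hi'
    have c3 : (0 : ℝ) ≤ j := by exact_mod_cast hj
    have c4 : (j : ℝ) ≤ 1 := by exact_mod_cast hj'
    refine hcone _ ?_ ?_ <;>
    · simp only [lat, Prod.fst_sub, Prod.snd_sub]
      push_cast
      rw [abs_le]
      constructor <;> linarith
  have hk0 : ⌊q.1⌋ ≠ 0 ∨ ⌊q.2⌋ ≠ 0 := by
    by_contra! hk
    obtain ⟨a, b, ha, hb, hab⟩ := hcone' 0 0 le_rfl zero_le_one le_rfl zero_le_one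
    have h1 := congrArg Prod.fst hab
    have h2 := congrArg Prod.snd hab
    simp only [lat, hk.1, hk.2, Prod.fst_add, Prod.snd_add, Prod.smul_fst, Prod.smul_snd,
      smul_eq_mul, add_zero, Int.cast_zero] at h1 h2
    have h3 : a * D = 0 := by rw [hD]; linear_combination (-h.2) * h1 + h.1 * h2
    exact hd ((mul_eq_zero.1 h3).resolve_left ha.ne')
  have h00 := hcone' 0 0 le_rfl zero_le_one le_rfl zero_le_one
  rcases hk0 with hk | hk
  · refine ⟨_, _, ?_, h00, hcone' 0 1 le_rfl zero_le_one zero_le_one le_rfl⟩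
    have : (⌊q.1⌋ : ℝ) ≠ 0 := by exact_mod_cast hk
    simp only [crossDet, lat]
    push_cast
    ring_nf
    exact this
  · refine ⟨_, _, ?_, h00, hcone' 1 0 zero_le_one le_rfl le_rfl zero_le_one⟩
    have : (⌊q.2⌋ : ℝ) ≠ 0 := by exact_mod_cast hk
    simp only [crossDet, lat]
    push_cast
    ring_nf
    simpa using this

/-- Invariant curves that agree on a half line have parallel periods. -/
theorem eq_of_periodic_of_eqOn {Γ₁ Γ₂ : ℝ → ℝ × ℝ} (h₁ : Continuous Γ₁) (h₂ : Continuous Γ₂)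
    {L₁ L₂ : ℝ} (hL₁ : 0 < L₁) (hL₂ : 0 < L₂) {v₁ v₂ : ℝ × ℝ}
    (hp₁ : ∀ t, Γ₁ (t + L₁) = Γ₁ t + v₁) (hp₂ : ∀ t, Γ₂ (t + L₂) = Γ₂ t + v₂)
    (heq : ∀ t, 0 ≤ t → Γ₁ t = Γ₂ t) : L₁⁻¹ • v₁ = L₂⁻¹ • v₂ := by
  have hbd : ∀ (Γ : ℝ → ℝ × ℝ) (L : ℝ) (v : ℝ × ℝ), 0 < L → Continuous Γ →
      (∀ t, Γ (t + L) = Γ t + v) → ∃ B, ∀ t, ‖Γ t - t • L⁻¹ • v‖ ≤ B := by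
    intro Γ L v hL hΓ hp
    have hper : Function.Periodic (fun t => Γ t - t • L⁻¹ • v) L := by
      intro t
      simp only [hp, add_smul, smul_inv_smul₀ hL.ne']
      abel
    obtain ⟨B, hB⟩ := (hper.isBounded_of_continuous hL.ne' (by fun_prop)).exists_norm_le
    exact ⟨B, fun t => hB _ (mem_range_self t)⟩
  obtain ⟨B₁, hB₁⟩ := hbd Γ₁ L₁ v₁ hL₁ h₁ hp₁
  obtain ⟨B₂, hB₂⟩ := hbd Γ₂ L₂ v₂ hL₂ h₂ hp₂
  by_contra hne
  have hpos := norm_pos_iff.2 (sub_ne_zero.2 hne)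
  obtain ⟨t, ht⟩ : ∃ t, t = (B₁ + B₂ + 1) / ‖L₁⁻¹ • v₁ - L₂⁻¹ • v₂‖ := ⟨_, rfl⟩
  have hB₁0 := (norm_nonneg _).trans (hB₁ 0)
  have hB₂0 := (norm_nonneg _).trans (hB₂ 0)
  have ht0 : 0 ≤ t := by rw [ht]; positivity
  have h3 : ‖t • (L₁⁻¹ • v₁ - L₂⁻¹ • v₂)‖ = B₁ + B₂ + 1 := by
    rw [norm_smul, Real.norm_of_nonneg ht0, ht, div_mul_cancel₀ _ hpos.ne']
  have h4 := norm_sub_le (Γ₂ t - t • L₂⁻¹ • v₂) (Γ₁ t - t • L₁⁻¹ • v₁)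
  rw [heq t ht0, show Γ₂ t - t • L₂⁻¹ • v₂ - (Γ₂ t - t • L₁⁻¹ • v₁) =
    t • (L₁⁻¹ • v₁ - L₂⁻¹ • v₂) by module, h3] at h4
  have h5 := hB₁ t
  rw [heq t ht0] at h5
  linarith [hB₂ t]

namespace TorusMetric

variable (M : TorusMetric)

theorem exists_calibrated_axis {ω : (ℝ × ℝ) →L[ℝ] ℝ} {k : ℤ × ℤ} (hk : k ≠ 0)
    (hω : ω (lat k) = M.stable (lat k)) :
    ∃ (n : ℕ) (L : ℝ) (Γ : ℝ → ℝ × ℝ), 0 < n ∧ 0 < L ∧ L = ω (lat (n • k)) ∧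
      (∀ t, Γ (t + L) = Γ t + lat (n • k)) ∧ Continuous Γ ∧ ∀ a b, M.IsSeg Γ a b := by
  obtain ⟨n, hn, x, hx⟩ := M.exists_dist_eq_stable hk
  have hn' : (0 : ℝ) < n := by exact_mod_cast hn
  have hL : 0 < M.stable (lat (n • k)) := by
    rw [lat_nsmul, stable_nsmul]
    exact mul_pos hn' (M.stable_pos (lat_ne_zero hk))
  obtain ⟨Γ, hper, hlip⟩ := M.exists_periodic_curve hL hx
  refine ⟨n, _, Γ, hn, hL, ?_, hper, M.continuous_of_dist_le hlip,
    M.isSeg_of_periodic hL rfl hper hlip⟩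
  rw [lat_nsmul, stable_nsmul, map_smul, hω, smul_eq_mul]

/-- Calibrated axes of independent translations do not exist simultaneously. -/
theorem not_crossing_axes {ω : (ℝ × ℝ) →L[ℝ] ℝ} (hω : ∀ h, ω h ≤ M.stable h) {k₁ k₂ : ℤ × ℤ}
    {L₁ L₂ : ℝ} (hL₁ : 0 < L₁) (hL₂ : 0 < L₂) (hωL₁ : L₁ = ω (lat k₁)) (hωL₂ : L₂ = ω (lat k₂))
    {Γ₁ Γ₂ : ℝ → ℝ × ℝ} (hp₁ : ∀ t, Γ₁ (t + L₁) = Γ₁ t + lat k₁)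
    (hp₂ : ∀ t, Γ₂ (t + L₂) = Γ₂ t + lat k₂) (h₁ : ∀ a b, M.IsSeg Γ₁ a b)
    (h₂ : ∀ a b, M.IsSeg Γ₂ a b) (h0 : Γ₁ 0 = Γ₂ 0) (t : ℝ) (ht : 0 ≤ t) : Γ₁ t = Γ₂ t := by
  obtain ⟨η, hη⟩ : ∃ η : ℝ → ℝ × ℝ, η = fun t => if t ≤ 0 then Γ₁ t else Γ₂ t := ⟨_, rfl⟩
  have hη1 : ∀ t, t ≤ 0 → η t = Γ₁ t := fun t ht => by rw [hη]; exact if_pos ht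
  have hη2 : ∀ t, 0 ≤ t → η t = Γ₂ t := by
    intro t ht
    rcases ht.eq_or_lt with rfl | ht
    · rw [hη1 0 le_rfl, h0]
    · rw [hη]
      exact if_neg ht.not_ge
  have hd1 : ∀ s t, s ≤ t → M.dist (Γ₁ s) (Γ₁ t) = t - s := fun s t hst =>
    h₁ s t s t le_rfl hst le_rfl
  have hd2 : ∀ s t, s ≤ t → M.dist (Γ₂ s) (Γ₂ t) = t - s := fun s t hst =>
    h₂ s t s t le_rfl hst le_rfl
  have hηseg : ∀ a b, M.IsSeg η a b := by
    intro a b s t _ hst _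
    rcases le_total t 0 with ht | ht
    · rw [hη1 s (hst.trans ht), hη1 t ht, hd1 s t hst]
    rcases le_total 0 s with hs | hs
    · rw [hη2 s hs, hη2 t ht, hd2 s t hst]
    rw [hη1 s hs, hη2 t ht]
    have a1 := M.dist_triangle (Γ₁ s) (Γ₁ 0) (Γ₂ t)
    have a2 := hd1 s 0 hs
    have a3 := hd2 0 t ht
    rw [← h0] at a3
    obtain ⟨n, hn⟩ := exists_nat_ge (max (-s / L₁) (t / L₂))
    have hn1 := (le_max_left _ _).trans hn
    have hn2 := (le_max_right _ _).trans hn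
    rw [div_le_iff₀ hL₁] at hn1
    rw [div_le_iff₀ hL₂] at hn2
    have c1 := apply_add_zsmul_of_periodic hp₁ 0 (-n)
    have c2 := apply_add_zsmul_of_periodic hp₂ 0 n
    push_cast at c1 c2
    rw [zero_add] at c1 c2
    have c3 : Γ₂ (n * L₂) = Γ₁ (-n * L₁) + lat (n • (k₁ + k₂)) := by
      rw [c1, c2, lat_nsmul, lat_add, h0]
      module
    have b1 := M.stable_lat_le (n • (k₁ + k₂)) (Γ₁ (-n * L₁))
    have b2 := hω (lat (n • (k₁ + k₂)))
    have b3 : ω (lat (n • (k₁ + k₂))) = n * L₁ + n * L₂ := by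
      rw [lat_nsmul, lat_add, map_smul, map_add, ← hωL₁, ← hωL₂, smul_eq_mul, mul_add]
    rw [← c3] at b1
    have b4 := hd1 (-n * L₁) s (by linarith)
    have b5 := hd2 t (n * L₂) (by linarith)
    have b6 := M.dist_triangle (Γ₁ (-n * L₁)) (Γ₁ s) (Γ₂ (n * L₂))
    have b7 := M.dist_triangle (Γ₁ s) (Γ₂ t) (Γ₂ (n * L₂))
    linarith
  obtain ⟨e₁, y₁, hs₁, he₁⟩ := M.exists_isSol_of_isSeg_Ici (a := -1) fun b => h₁ (-1) b
  obtain ⟨e₂, y₂, hs₂, he₂⟩ := M.exists_isSol_of_isSeg_Ici (a := -1) fun b => hηseg (-1) b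
  have heq : e₁ = e₂ := hs₁.ext_of_eqOn hs₂ (show (-1 : ℝ) < 0 by norm_num) fun u hu => by
    rw [← he₁ hu.1, ← he₂ hu.1, hη1 u hu.2]
  have hm : t ∈ Ici (-1 : ℝ) := by
    rw [mem_Ici]
    linarith
  rw [he₁ hm, heq, ← he₂ hm, hη2 t ht]

/-- The stable norm is strictly convex. -/
theorem exists_eq_smul_of_calibrated {ω : (ℝ × ℝ) →L[ℝ] ℝ} (hω : ∀ h, ω h ≤ M.stable h)
    {e h : ℝ × ℝ} (he : e ≠ 0) (hωe : ω e = M.stable e) (hωh : ω h = M.stable h) :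
    ∃ a : ℝ, h = a • e := by
  refine eq_smul_of_crossDet_eq_zero he ?_
  by_contra hd
  obtain ⟨k₁, k₂, hk, hc₁, hc₂⟩ := exists_lat_mem_cone hd
  have hcal : ∀ k, (∃ a b : ℝ, 0 < a ∧ 0 < b ∧ lat k = a • e + b • h) →
      ω (lat k) = M.stable (lat k) := by
    rintro k ⟨a, b, ha, hb, hab⟩
    refine le_antisymm (hω _) ?_
    have := M.stable_add (a • e) (b • h)
    rw [M.stable_smul ha, M.stable_smul hb, ← hωe, ← hωh] at this
    rw [hab, map_add, map_smul, map_smul]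
    exact this
  have hk₁ : k₁ ≠ 0 := by
    rintro rfl
    simp [crossDet, lat] at hk
  have hk₂ : k₂ ≠ 0 := by
    rintro rfl
    simp [crossDet, lat] at hk
  obtain ⟨n₁, L₁, Γ₁, hn₁, hL₁, hωL₁, hp₁, hΓ₁, hseg₁⟩ :=
    M.exists_calibrated_axis hk₁ (hcal k₁ hc₁)
  obtain ⟨n₂, L₂, Γ₂, hn₂, hL₂, hωL₂, hp₂, hΓ₂, hseg₂⟩ :=
    M.exists_calibrated_axis hk₂ (hcal k₂ hc₂)
  have hn₁' : (n₁ : ℝ) ≠ 0 := by exact_mod_cast hn₁.ne'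
  have hn₂' : (n₂ : ℝ) ≠ 0 := by exact_mod_cast hn₂.ne'
  have hcross : crossDet (lat (n₁ • k₁)) (lat (n₂ • k₂)) ≠ 0 := by
    have : crossDet (lat (n₁ • k₁)) (lat (n₂ • k₂)) =
        n₁ * n₂ * crossDet (lat k₁) (lat k₂) := by
      rw [lat_nsmul, lat_nsmul]
      simp only [crossDet, Prod.smul_fst, Prod.smul_snd, smul_eq_mul]
      ring
    rw [this]
    exact mul_ne_zero (mul_ne_zero hn₁' hn₂') hk
  obtain ⟨s, t, hst⟩ := exists_eq_of_crossDet_ne_zero hΓ₁ hΓ₂ hL₁ hL₂ hcross hp₁ hp₂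
  have hshift : ∀ (Γ : ℝ → ℝ × ℝ) (u : ℝ), (∀ a b, M.IsSeg Γ a b) →
      ∀ a b, M.IsSeg (fun τ => Γ (τ + u)) a b := by
    intro Γ u hΓ a b σ τ _ hστ _
    rw [hΓ (σ + u) (τ + u) (σ + u) (τ + u) le_rfl (by linarith) le_rfl]
    ring
  have hq₁ : ∀ τ, Γ₁ (τ + L₁ + s) = Γ₁ (τ + s) + lat (n₁ • k₁) := fun τ => by
    rw [add_right_comm, hp₁]
  have hq₂ : ∀ τ, Γ₂ (τ + L₂ + t) = Γ₂ (τ + t) + lat (n₂ • k₂) := fun τ => by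
    rw [add_right_comm, hp₂]
  have heq := M.not_crossing_axes hω (Γ₁ := fun τ => Γ₁ (τ + s)) (Γ₂ := fun τ => Γ₂ (τ + t))
    hL₁ hL₂ hωL₁ hωL₂ hq₁ hq₂ (hshift Γ₁ s hseg₁) (hshift Γ₂ t hseg₂) (by simpa using hst)
  have hpar := eq_of_periodic_of_eqOn (Γ₁ := fun τ => Γ₁ (τ + s)) (Γ₂ := fun τ => Γ₂ (τ + t))
    (by fun_prop) (by fun_prop) hL₁ hL₂ hq₁ hq₂ heq
  rw [inv_smul_eq_iff₀ hL₁.ne'] at hpar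
  rw [hpar] at hcross
  refine hcross ?_
  simp only [crossDet, Prod.smul_fst, Prod.smul_snd, smul_eq_mul]
  ring

end TorusMetric

end

/-- For every `r ∈ ℝ ∪ {∞}` and every point `x` of `T²` (represented by a lift `x ∈ ℝ²`;
every point of `T²` admits a lift and the statement is invariant under deck
transformations) there exists a unit tangent vector `v ∈ S_x T²` — namely `v = ċ(0)` for
the geodesic `c` below — such that the lifted geodesic `c` with `c(0) = x` has an escaping
forward ray with well-defined asymptotic direction and rotation number `ρ(c⁺) = r`.
In particular the map `f_x : E_x → ℝ ∪ {∞}`, `v ↦ ρ(v)`, is surjective. -/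
theorem stmt12 (M : TorusMetric) (r : OnePoint ℝ) (x : ℝ × ℝ) :
    ∃ (c : ℝ → ℝ × ℝ) (z : ℝ × ℝ), M.IsGeodesic c ∧ c 0 = x ∧
      EscapesForward c ∧ HasDirection c z ∧ projPt z = r := by
  obtain ⟨e, he, rfl⟩ := exists_projPt_eq r
  obtain ⟨ω, hω, hωe⟩ := M.exists_calibration he
  obtain ⟨γ, C, h0, hγ, hC⟩ := M.exists_ray hω he hωe x
  have hlim := M.tendsto_ray hω he hωe
    (fun h hh => M.exists_eq_smul_of_calibrated hω he hωe hh) h0 hγ hC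
  obtain ⟨c, y, hsol, heq⟩ := M.exists_isSol_of_isSeg_Ici hγ
  have hσ := inv_ne_zero (M.stable_pos he).ne'
  have hne : (M.stable e)⁻¹ • e ≠ 0 := smul_ne_zero hσ he
  have hlim' : Tendsto (fun t => t⁻¹ • (c t - x)) atTop (𝓝 ((M.stable e)⁻¹ • e)) := by
    refine hlim.congr' ?_
    filter_upwards [eventually_ge_atTop 0] with t ht
    rw [heq ht]
  obtain ⟨hesc, hdir⟩ := escapes_of_tendsto hne hlim'
  refine ⟨c, _, hsol.isGeodesic, ?_, hesc, hdir, ?_⟩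
  · rw [← heq self_mem_Ici, h0]
  · rw [projPt_smul (inv_ne_zero (norm2_pos hne).ne'), projPt_smul hσ]
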